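/- Let A = kQ/I be a toupie algebra over a field k with t ≥ 2 branches and m = dim_k e_0 A e_∞, where 0 is the unique source and ∞ the unique sink of Q. Then A is hereditary (i.e., gl.dim A ≤ 1) if and only if m = t. -/

import Mathlib

/-!
Formalization preamble for "Toupie algebras".

We realize the bound quiver algebra `A = kQ/I` of a toupie quiver `Q` concretely:
the path algebra `kQ` is realized, via its (faithful) left regular representation,
as the subalgebra of `Module.End k (paths → k)` generated by the operators of left
multiplication by the trivial paths `e_v` and by the arrows of `Q`.  Paths are
composed from left to right (`p * q` = "first `p`, then `q`"), as in
Assem–Simson–Skowroński, so that paths from the source `0` to the sink `∞` span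
`e₀ (kQ) e∞`, and (right) `A`-modules are identified with representations of `(Q, I)`.
Right `A`-modules are formalized as (left) modules over `Aᵐᵒᵖ`.
-/

set_option synthInstance.maxHeartbeats 400000
set_option maxHeartbeats 800000

noncomputable section
open scoped Classical
open MulOpposite

universe u

namespace Toupie

/-- Vertices of a toupie quiver with `t` branches, branch `i` having length `ℓ i ≥ 1`:
the unique source `src`, the unique sink `snk`, and for each branch `i` its interior
vertices `mid i a` (the `(a+1)`-st vertex on branch `i`, for `a : Fin (ℓ i - 1)`). -/
inductive Vtx (t : ℕ) (ℓ : Fin t → ℕ) : Type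
  | src : Vtx t ℓ
  | snk : Vtx t ℓ
  | mid (i : Fin t) (a : Fin (ℓ i - 1)) : Vtx t ℓ

/-- The `a`-th vertex on branch `i`, for `0 ≤ a ≤ ℓ i`
(`a = 0` is the source, `a = ℓ i` is the sink). -/
def vtx (t : ℕ) (ℓ : Fin t → ℕ) (i : Fin t) (a : ℕ) : Vtx t ℓ :=
  if a = 0 then .src else if h : a - 1 < ℓ i - 1 then .mid i ⟨a - 1, h⟩ else .snk

/-- The paths of a toupie quiver: trivial paths at the vertices, and for each branch
`i` and `a < b ≤ ℓ i` the path `sub i a b` along branch `i` from its `a`-th vertex to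
its `b`-th vertex.  (`sub i 0 (ℓ i)` is the `i`-th branch `w i`.) -/
inductive PIdx (t : ℕ) (ℓ : Fin t → ℕ) : Type
  | vert (v : Vtx t ℓ) : PIdx t ℓ
  | sub (i : Fin t) (a b : ℕ) (hab : a < b) (hb : b ≤ ℓ i) : PIdx t ℓ

variable (k : Type u) [Field k] (t : ℕ) (ℓ : Fin t → ℕ)

/-- The vector space with basis the set of paths of the toupie quiver. -/
abbrev PSp : Type u := PIdx t ℓ → k

variable {t ℓ}

/-- The starting vertex of a path. -/
def startIdx : PIdx t ℓ → Vtx t ℓ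
  | .vert v => v
  | .sub i a _ _ _ => vtx t ℓ i a

/-- Left multiplication by the trivial path (primitive idempotent) `e_v`. -/
def Ev (v : Vtx t ℓ) : Module.End k (PSp k t ℓ) where
  toFun f := fun p => if startIdx p = v then f p else 0
  map_add' f g := by funext p; by_cases h : startIdx p = v <;> simp [h]
  map_smul' c f := by funext p; by_cases h : startIdx p = v <;> simp [h]

/-- Strip the `j`-th arrow of branch `i` (the arrow `vtx i j ⟶ vtx i (j+1)`) from the
front of a path, if possible. -/
def strip (i : Fin t) (j : ℕ) : PIdx t ℓ → Option (PIdx t ℓ)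
  | .vert _ => none
  | .sub i' a b _ hb =>
      if h : i' = i ∧ a = j then
        if hb2 : j + 1 < b then some (.sub i (j + 1) b hb2 (h.1 ▸ hb))
        else some (.vert (vtx t ℓ i b))
      else none

/-- Left multiplication by the `j`-th arrow of branch `i`
(the arrow from `vtx i j` to `vtx i (j+1)`, for `j < ℓ i`; the zero operator for junk `j`). -/
def Ar (i : Fin t) (j : ℕ) : Module.End k (PSp k t ℓ) where
  toFun f := fun p => (strip i j p).elim 0 f
  map_add' f g := by funext p; rcases h : strip i j p with _ | q <;> simp [h]
  map_smul' c f := by funext p; rcases h : strip i j p with _ | q <;> simp [h]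

variable (t ℓ)

/-- The generators of the path algebra: the trivial paths and the arrows. -/
def gens : Set (Module.End k (PSp k t ℓ)) :=
  Set.range (Ev k) ∪ {x | ∃ i j, x = Ar k i j}

/-- The path algebra `kQ` of the toupie quiver, realized as the subalgebra of
`Module.End k (PSp k t ℓ)` generated by left multiplication by trivial paths and arrows. -/
def PathAlg : Subalgebra k (Module.End k (PSp k t ℓ)) :=
  Algebra.adjoin k (gens k t ℓ)

variable {k t ℓ}

/-- The trivial path `e_v` as an element of the path algebra. -/
def eV (v : Vtx t ℓ) : PathAlg k t ℓ :=
  ⟨Ev k v, Algebra.subset_adjoin (Or.inl ⟨v, rfl⟩)⟩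

/-- The `j`-th arrow of branch `i` as an element of the path algebra. -/
def arE (i : Fin t) (j : ℕ) : PathAlg k t ℓ :=
  ⟨Ar k i j, Algebra.subset_adjoin (Or.inr ⟨i, j, rfl⟩)⟩

/-- The path along branch `i` from its `a`-th vertex to its `b`-th vertex, as an element
of the path algebra: the product (composed from left to right) of the arrows
`a → a+1 → ⋯ → b`.  (For `b ≤ a` this is the empty product `1`.) -/
def subE (i : Fin t) (a b : ℕ) : PathAlg k t ℓ :=
  (((List.range (b - a)).map fun s => arE i (a + s)).prod)

/-- The `i`-th branch `w i` (the path from the source to the sink along branch `i`)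
as an element of the path algebra. -/
def wE (i : Fin t) : PathAlg k t ℓ := subE i 0 (ℓ i)

variable {k : Type u} [Field k]

/-- A toupie algebra `A = kQ/I`: a toupie quiver `Q` (a non-linear quiver with a unique
source, a unique sink, and all other vertices having exactly one incoming and one
outgoing arrow, i.e. `t ≥ 2` branches of lengths `ℓ i ≥ 1`), together with an admissible
ideal `I` of the path algebra `kQ`.  Since `Q` is finite and acyclic, the arrow ideal is
nilpotent, so admissibility amounts to `I ⊆ R_Q²`, i.e. every element of `I` is a linear
combination of paths of length `≥ 2`. -/
structure ToupieAlg (k : Type u) [Field k] : Type u where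
  t : ℕ
  ht : 2 ≤ t
  ℓ : Fin t → ℕ
  hℓ : ∀ i, 1 ≤ ℓ i
  I : TwoSidedIdeal (PathAlg k t ℓ)
  adm : ∀ x ∈ I, x ∈ Submodule.span k
    {y : PathAlg k t ℓ | ∃ i a b, a + 2 ≤ b ∧ b ≤ ℓ i ∧ y = subE i a b}

variable (T : ToupieAlg k)

/-- The underlying algebra `A = kQ/I` of a toupie algebra. -/
def Alg : Type u := T.I.ringCon.Quotient

instance : Ring (Alg T) := inferInstanceAs (Ring T.I.ringCon.Quotient)

/-- The quotient map `kQ → A = kQ/I`. -/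
def mkA : PathAlg k T.t T.ℓ →+* Alg T := T.I.ringCon.mk'

lemma mkA_surjective : Function.Surjective (mkA T) := Quotient.mk''_surjective

instance : Algebra k (Alg T) :=
  RingHom.toAlgebra' ((mkA T).comp (algebraMap k (PathAlg k T.t T.ℓ)))
    (by
      intro c x
      obtain ⟨y, rfl⟩ := mkA_surjective T x
      simp only [RingHom.coe_comp, Function.comp_apply, ← map_mul]
      rw [Algebra.commutes])

/-- The idempotent `e₀` (at the source) in `A`. -/
def e0 : Alg T := mkA T (eV Vtx.src)

/-- The idempotent `e∞` (at the sink) in `A`. -/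
def einf : Alg T := mkA T (eV Vtx.snk)

/-- The `k`-linear map `A → A`, `x ↦ e₀ * x * e∞`, whose range is `e₀ A e∞`. -/
def lrMap : Alg T →ₗ[k] Alg T where
  toFun x := e0 T * x * einf T
  map_add' x y := by simp [mul_add, add_mul]
  map_smul' c x := by
    simp only [RingHom.id_apply]
    rw [mul_smul_comm, smul_mul_assoc]

/-- `m = dim_k e₀ A e∞`, the dimension of the span of the (residues of the) paths from
the source to the sink. -/
def mDim : ℕ := Module.finrank k ↥(LinearMap.range (lrMap T))

/-- The branch `w i` lies in the ideal `I`. -/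
def branchInI (i : Fin T.t) : Prop := wE i ∈ T.I

/-- A minimal relation: `∑_{i ∈ J} λ i • w i ∈ I` with `|J| ≥ 2`, all `λ i ≠ 0`, and no
nonempty proper subsum in `I`. -/
def MinRel (J : Finset (Fin T.t)) (lam : Fin T.t → k) : Prop :=
  2 ≤ J.card ∧ (∀ i ∈ J, lam i ≠ 0) ∧ (∑ i ∈ J, lam i • wE i) ∈ T.I ∧
    ∀ J' ⊂ J, J'.Nonempty → (∑ i ∈ J', lam i • wE i) ∉ T.I

/-- A toupie algebra is simply connected if any two distinct branches are involved in a
common minimal relation. -/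
def SimplyConnected : Prop :=
  ∀ i j : Fin T.t, i ≠ j → ∃ J lam, MinRel T J lam ∧ i ∈ J ∧ j ∈ J

/-- A (minimal) zero-relation on branch `i`: the subpath of branch `i` from its `a`-th
to its `b`-th vertex lies in `I`, but no proper subpath of it does. -/
def ZeroRel (i : Fin T.t) (a b : ℕ) : Prop :=
  a < b ∧ b ≤ T.ℓ i ∧ subE i a b ∈ T.I ∧
    ∀ a' b', a ≤ a' → b' ≤ b → a' < b' → (a', b') ≠ (a, b) → subE i a' b' ∉ T.I

/-- There is exactly one relation on branch `i`. -/
def ExactlyOneRel (i : Fin T.t) : Prop := ∃! p : ℕ × ℕ, ZeroRel T i p.1 p.2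

/-- Branch `i` carries more than one relation. -/
def MoreThanOneRel (i : Fin T.t) : Prop :=
  ∃ p q : ℕ × ℕ, p ≠ q ∧ ZeroRel T i p.1 p.2 ∧ ZeroRel T i q.1 q.2

/-- At most one branch of `Q` has length at least three. -/
def AtMostOneLongBranch : Prop := ∀ i j : Fin T.t, 3 ≤ T.ℓ i → 3 ≤ T.ℓ j → i = j

/-- The two-sided ideal `I` is generated by the set `S`. -/
def IsGenBy {R : Type u} [Ring R] (I : TwoSidedIdeal R) (S : Set R) : Prop :=
  S ⊆ (I : Set R) ∧ ∀ J : TwoSidedIdeal R, S ⊆ (J : Set R) → (I : Set R) ⊆ (J : Set R)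

/-- A toupie algebra is canonical if (after choosing two distinguished branches `i₁, i₂`)
its ideal is generated by `{w i₁ + λ j • w i₂ - w j}` over the remaining branches `j`,
with the `λ j` pairwise distinct and nonzero. -/
def IsCanonical : Prop :=
  ∃ (i₁ i₂ : Fin T.t) (lam : Fin T.t → k), i₁ ≠ i₂ ∧
    (∀ j, j ≠ i₁ → j ≠ i₂ → lam j ≠ 0) ∧
    (∀ j j', j ≠ i₁ → j ≠ i₂ → j' ≠ i₁ → j' ≠ i₂ → j ≠ j' → lam j ≠ lam j') ∧
    IsGenBy T.I {x | ∃ j, j ≠ i₁ ∧ j ≠ i₂ ∧ x = wE i₁ + lam j • wE i₂ - wE j}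

end Toupie
namespace Toupie

/-! ### Module-theoretic notions over an arbitrary ring

Following the paper, all modules are finite-dimensional *right* modules; a right
`A`-module is formalized as a (left) module over `Aᵐᵒᵖ`.  The definitions below are
stated for modules over an arbitrary ring `R` and are applied with `R := Aᵐᵒᵖ`. -/

variable (R : Type u) [Ring R]

/-- A module is indecomposable if it is nonzero and its only idempotent endomorphisms
are `0` and the identity. -/
def Indec (M : ModuleCat.{u} R) : Prop :=
  Nontrivial M ∧ ∀ f : M →ₗ[R] M, f.comp f = f → f = 0 ∨ f = LinearMap.id

/-- Finiteness ("finite dimensionality") of a module. -/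
def FdMod (M : ModuleCat.{u} R) : Prop := Module.Finite R M

/-- `M` has projective dimension at most one: it is the quotient of a projective module
by a projective submodule. -/
def PdLeOne (M : ModuleCat.{u} R) : Prop :=
  ∃ (P : ModuleCat.{u} R) (f : P →ₗ[R] M), Function.Surjective f ∧
    Module.Projective R P ∧ Module.Projective R ↥(LinearMap.ker f)

/-- `M` has injective dimension at most one: it embeds in an injective module with
injective cokernel. -/
def IdLeOne (M : ModuleCat.{u} R) : Prop :=
  ∃ (E : ModuleCat.{u} R) (f : M →ₗ[R] E), Function.Injective f ∧
    Module.Injective R E ∧ Module.Injective R (E ⧸ LinearMap.range f)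

/-- One step of a path in `ind R`: a nonzero non-isomorphism between (finite-dimensional)
indecomposable modules. -/
def Step (M N : ModuleCat.{u} R) : Prop :=
  Indec R M ∧ FdMod R M ∧ Indec R N ∧ FdMod R N ∧
    ∃ f : M →ₗ[R] N, f ≠ 0 ∧ ¬ Function.Bijective f

/-- A path in `ind R` from `M` to `N` (possibly trivial): a chain
`M = M₀ → M₁ → ⋯ → Mₙ = N` of nonzero non-isomorphisms between indecomposables. -/
def IndPath (M N : ModuleCat.{u} R) : Prop := Relation.ReflTransGen (Step R) M N

/-- The left part `L_R`: the indecomposable (finite-dimensional) modules `M` such that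
every indecomposable `X` with a path `X ⇝ M` in `ind R` has projective dimension `≤ 1`. -/
def InLeftPart (M : ModuleCat.{u} R) : Prop :=
  Indec R M ∧ FdMod R M ∧
    ∀ X : ModuleCat.{u} R, Indec R X → FdMod R X → IndPath R X M → PdLeOne R X

/-- The right part `R_R`: the indecomposable (finite-dimensional) modules `M` such that
every indecomposable `X` with a path `M ⇝ X` in `ind R` has injective dimension `≤ 1`. -/
def InRightPart (M : ModuleCat.{u} R) : Prop :=
  Indec R M ∧ FdMod R M ∧
    ∀ X : ModuleCat.{u} R, Indec R X → FdMod R X → IndPath R M X → IdLeOne R X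

/-- Hereditary: global dimension at most one, i.e. every module has projective dimension
at most one. -/
def Hereditary : Prop := ∀ M : ModuleCat.{u} R, PdLeOne R M

/-- Quasitilted: every indecomposable projective module lies in the left part. -/
def Quasitilted : Prop :=
  ∀ P : ModuleCat.{u} R, Indec R P → FdMod R P → Module.Projective R P → InLeftPart R P

/-- A module is directed if it lies on no cycle of nonzero non-isomorphisms between
indecomposables in `ind R`. -/
def Directed (M : ModuleCat.{u} R) : Prop := ¬ Relation.TransGen (Step R) M M

/-- Weakly shod: every indecomposable (finite-dimensional) module not lying in
`L_R ∪ R_R` is directed. -/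
def WeaklyShod : Prop :=
  ∀ M : ModuleCat.{u} R, Indec R M → FdMod R M →
    ¬ InLeftPart R M → ¬ InRightPart R M → Directed R M

/-- Laura: all but finitely many isomorphism classes of indecomposable
(finite-dimensional) modules lie in `L_R ∪ R_R`. -/
def Laura : Prop :=
  ∃ S : Set (ModuleCat.{u} R), S.Finite ∧
    ∀ M : ModuleCat.{u} R, Indec R M → FdMod R M →
      ¬ InLeftPart R M → ¬ InRightPart R M → ∃ N ∈ S, Nonempty (M ≃ₗ[R] N)

/-- There are exactly `n` isomorphism classes of modules satisfying `P`. -/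
def NumClasses (P : ModuleCat.{u} R → Prop) (n : ℕ) : Prop :=
  ∃ f : Fin n → ModuleCat.{u} R, (∀ i, P (f i)) ∧
    (∀ i j, Nonempty ((f i : Type u) ≃ₗ[R] (f j : Type u)) → i = j) ∧
    ∀ M : ModuleCat.{u} R, P M → ∃ i, Nonempty ((M : Type u) ≃ₗ[R] (f i : Type u))

/-- `M` is (isomorphic to) a direct summand of `T`. -/
def IsSummandOf (T : Type u) [AddCommGroup T] [Module R T] (M : ModuleCat.{u} R) : Prop :=
  ∃ N N' : Submodule R T, IsCompl N N' ∧ Nonempty ((M : Type u) ≃ₗ[R] N)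

/-- `Ext¹_R(T, T) = 0`: every self-extension `0 → T → E → T → 0` splits. -/
def SelfExtVanish (T : Type u) [AddCommGroup T] [Module R T] : Prop :=
  ∀ (E : Type u) [AddCommGroup E] [Module R E] (ι : T →ₗ[R] E) (π : E →ₗ[R] T),
    Function.Injective ι → Function.Surjective π → LinearMap.range ι = LinearMap.ker π →
      ∃ s : T →ₗ[R] E, π.comp s = LinearMap.id

/-- A tilting module over a hereditary algebra: a finite module with `Ext¹(T,T) = 0`
having as many pairwise non-isomorphic indecomposable direct summands as there are
simple modules. -/
def IsTiltingMod (T : Type u) [AddCommGroup T] [Module R T] : Prop :=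
  Module.Finite R T ∧ SelfExtVanish R T ∧
    ∃ n : ℕ, NumClasses R (fun M => Indec R M ∧ IsSummandOf R T M) n ∧
      NumClasses R (fun M => IsSimpleModule R M) n

variable (k : Type u) [Field k]

/-- A `k`-algebra `A` is tilted if it is the endomorphism algebra of a tilting (right)
module over a hereditary finite-dimensional `k`-algebra `H`.  (Right `H`-modules are
modules over `Hᵐᵒᵖ`; the isomorphism `A ≅ End_H T` is a `k`-linear ring isomorphism.) -/
def IsTilted (A : Type u) [Ring A] [Algebra k A] : Prop :=
  ∃ (H : Type u) (_ : Ring H) (_ : Algebra k H),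
    FiniteDimensional k H ∧ Hereditary Hᵐᵒᵖ ∧
      ∃ (T : Type u) (_ : AddCommGroup T) (_ : Module Hᵐᵒᵖ T),
        IsTiltingMod Hᵐᵒᵖ T ∧
          ∃ (_ : Module k T) (_ : SMulCommClass Hᵐᵒᵖ k T) (_ : IsScalarTower k Hᵐᵒᵖ T)
            (φ : A ≃+* Module.End Hᵐᵒᵖ T), ∀ (c : k) (x : A), φ (c • x) = c • φ x

end Toupie
namespace Toupie

variable {k : Type u} [Field k] (T : ToupieAlg k)

/-! ### Right `A`-modules as representations of `(Q, I)`

For a right `A`-module `M` (a module over `Aᵐᵒᵖ`) and a vertex `v`, the space of the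
corresponding representation at `v` is `M_v = M • e_v`. -/

/-- The action of the idempotent `e_v ∈ A` on a right `A`-module (= `Aᵐᵒᵖ`-module). -/
def actV (v : Vtx T.t T.ℓ) : (Alg T)ᵐᵒᵖ := op (mkA T (eV v))

/-- The space `M_v = M • e_v` of the representation `M` at the vertex `v` is zero. -/
def VanishAt (M : ModuleCat.{u} (Alg T)ᵐᵒᵖ) (v : Vtx T.t T.ℓ) : Prop :=
  ∀ m : M, actV T v • m = 0

/-- Every simple summand of `top M = M / rad M` is one of the simple modules `S_v`,
`v ∈ vs`: for every maximal submodule `N` the simple quotient `M/N` is supported at some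
vertex of `vs` (for an admissible quotient of a path algebra, the simple module `S_v` is
the unique simple on which `e_v` acts nontrivially). -/
def TopIn (M : ModuleCat.{u} (Alg T)ᵐᵒᵖ) (vs : Set (Vtx T.t T.ℓ)) : Prop :=
  ∀ N : Submodule (Alg T)ᵐᵒᵖ M, IsCoatom N → ∃ v ∈ vs, ∃ m : M, actV T v • m ∉ N

/-- Every simple summand of the socle of `M` is one of the simple modules `S_v`,
`v ∈ vs`: every simple submodule `N ≤ M` is supported at some vertex of `vs`. -/
def SocIn (M : ModuleCat.{u} (Alg T)ᵐᵒᵖ) (vs : Set (Vtx T.t T.ℓ)) : Prop :=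
  ∀ N : Submodule (Alg T)ᵐᵒᵖ M, IsAtom N → ∃ v ∈ vs, ∃ m ∈ N, actV T v • m ≠ 0

/-- The module `D x y` (for two positions `0 ≤ x, y ≤ ℓ i₀` on the unique branch `i₀`
lying in `I`, and an auxiliary branch `i₂ ≠ i₀`): the right `A`-module with generators
`g = e₀` (at the source) and `h = e_y` (at the `y`-th vertex of branch `i₀`), subject to
the relations `g ⬝ (subpath of w i₀ from 0 to x+1) = 0` and
`g ⬝ w i₂ = h ⬝ (subpath of w i₀ from y to ℓ i₀)`.  It is presented as the quotient of
the right regular module `A ⊕ A` by the right submodule generated by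
`(1 - e₀, 0)`, `(0, 1 - e_y)`, `(subE i₀ 0 (min (x+1) (ℓ i₀)), 0)` and
`(w i₂, - subE i₀ y (ℓ i₀))`. -/
abbrev Dmod (i₀ i₂ : Fin T.t) (x y : ℕ) : Type u :=
  (Alg T × Alg T) ⧸ Submodule.span (Alg T)ᵐᵒᵖ
    ({((mkA T (1 - eV Vtx.src) : Alg T), (0 : Alg T)),
      ((0 : Alg T), (mkA T (1 - eV (vtx T.t T.ℓ i₀ y)) : Alg T)),
      ((mkA T (subE i₀ 0 (min (x + 1) (T.ℓ i₀))) : Alg T), (0 : Alg T)),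
      ((mkA T (wE i₂) : Alg T), (- mkA T (subE i₀ y (T.ℓ i₀)) : Alg T))} :
        Set (Alg T × Alg T))

end Toupie

namespace Toupie

section PathAlgebra

variable {k : Type u} [Field k] {t : ℕ} {ℓ : Fin t → ℕ}

instance : Finite (Vtx t ℓ) :=
  Finite.of_surjective
    (fun x : Bool ⊕ (Σ i : Fin t, Fin (ℓ i - 1)) =>
      match x with
      | .inl true => Vtx.src
      | .inl false => Vtx.snk
      | .inr ⟨i, a⟩ => Vtx.mid i a)
    (by
      rintro (_ | _ | ⟨i, a⟩)
      · exact ⟨.inl true, rfl⟩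
      · exact ⟨.inl false, rfl⟩
      · exact ⟨.inr ⟨i, a⟩, rfl⟩)

instance : Fintype (Vtx t ℓ) := Fintype.ofFinite _

instance : Finite (PIdx t ℓ) :=
  Finite.of_injective
    (fun p : PIdx t ℓ =>
      (match p with
      | .vert v => .inl v
      | .sub i a b hab hb =>
        .inr ⟨i, ⟨a, by omega⟩, ⟨b, by omega⟩⟩ :
        Vtx t ℓ ⊕ (Σ i : Fin t, Fin (ℓ i + 1) × Fin (ℓ i + 1))))
    (by
      rintro (v | ⟨i, a, b, hab, hb⟩) (w | ⟨j, c, d, hcd, hd⟩) h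
      · simpa using h
      · simp at h
      · simp at h
      · simp only [Sum.inr.injEq, Sigma.mk.injEq] at h
        obtain ⟨rfl, h⟩ := h
        simpa using h)

instance : Fintype (PIdx t ℓ) := Fintype.ofFinite _

lemma vtx_zero (i : Fin t) : vtx t ℓ i 0 = .src := rfl

lemma vtx_top (i : Fin t) {a : ℕ} (h0 : a ≠ 0) (h : ℓ i ≤ a) : vtx t ℓ i a = .snk := by
  simp [vtx, h0, show ¬ a - 1 < ℓ i - 1 by omega]

/-- Two positions, one of which is not the last of its branch and the other not the first,
give the same vertex only if they agree. -/
lemma vtx_inj {i j : Fin t} {a b : ℕ} (ha : a < ℓ i) (hb : b ≠ 0)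
    (h : vtx t ℓ i a = vtx t ℓ j b) : i = j ∧ a = b := by
  unfold vtx at h
  split_ifs at h with h1 h2 h3 h4 <;> try omega
  · simp only [Vtx.mid.injEq] at h
    obtain ⟨rfl, h⟩ := h
    simp only [heq_eq_eq, Fin.mk.injEq] at h
    exact ⟨rfl, by omega⟩

lemma strip_eq_some {i : Fin t} {j : ℕ} {p q : PIdx t ℓ} (h : strip i j p = some q) :
    startIdx p = vtx t ℓ i j ∧ startIdx q = vtx t ℓ i (j + 1) ∧ j < ℓ i := by
  rcases p with v | ⟨i', a, b, hab, hb⟩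
  · simp [strip] at h
  · simp only [strip] at h
    split_ifs at h with h1 h2
    · obtain ⟨rfl, rfl⟩ := h1
      cases h
      exact ⟨rfl, rfl, by omega⟩
    · obtain ⟨rfl, rfl⟩ := h1
      cases h
      obtain rfl : b = a + 1 := by omega
      exact ⟨rfl, rfl, by omega⟩

lemma eV_mul_eV (v w : Vtx t ℓ) :
    (eV v * eV w : PathAlg k t ℓ) = if v = w then eV v else 0 := by
  apply Subtype.ext
  apply LinearMap.ext
  intro f
  funext p
  split_ifs with h
  · subst h
    simp only [eV, Subalgebra.coe_mul, Module.End.mul_apply, Ev, LinearMap.coe_mk, AddHom.coe_mk]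
    split_ifs <;> rfl
  · simp only [eV, Subalgebra.coe_mul, Module.End.mul_apply, Ev, LinearMap.coe_mk, AddHom.coe_mk,
      ZeroMemClass.coe_zero, LinearMap.zero_apply, Pi.zero_apply]
    split_ifs with h1 h2
    · exact absurd (h1.symm.trans h2) h
    · rfl
    · rfl

lemma sum_eV : (∑ v, eV v : PathAlg k t ℓ) = 1 := by
  apply Subtype.ext
  apply LinearMap.ext
  intro f
  funext p
  simp [eV, Ev, LinearMap.sum_apply]

lemma eV_mul_arE (v : Vtx t ℓ) (i : Fin t) (j : ℕ) :
    (eV v * arE i j : PathAlg k t ℓ) = if v = vtx t ℓ i j then arE i j else 0 := by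
  apply Subtype.ext
  apply LinearMap.ext
  intro f
  funext p
  have key : ((eV v * arE i j : PathAlg k t ℓ) : Module.End k (PSp k t ℓ)) f p =
    if startIdx p = v then (strip i j p).elim 0 f else 0 := rfl
  have key2 : ((arE i j : PathAlg k t ℓ) : Module.End k (PSp k t ℓ)) f p =
    (strip i j p).elim 0 f := rfl
  rw [key]
  rcases hs : strip i j p with _ | q
  · split_ifs <;> simp [key2, hs]
  · obtain ⟨h1, h2, h3⟩ := strip_eq_some hs
    rw [h1, eq_comm]
    by_cases h : v = vtx t ℓ i j
    · simp [h, key2, hs]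
    · simp [h, Ne.symm h]

lemma arE_mul_eV (v : Vtx t ℓ) (i : Fin t) (j : ℕ) :
    (arE i j * eV v : PathAlg k t ℓ) = if v = vtx t ℓ i (j + 1) then arE i j else 0 := by
  apply Subtype.ext
  apply LinearMap.ext
  intro f
  funext p
  have key : ((arE i j * eV v : PathAlg k t ℓ) : Module.End k (PSp k t ℓ)) f p =
    (strip i j p).elim 0 (fun q => if startIdx q = v then f q else 0) := rfl
  have key2 : ((arE i j : PathAlg k t ℓ) : Module.End k (PSp k t ℓ)) f p =
    (strip i j p).elim 0 f := rfl
  rw [key]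
  rcases hs : strip i j p with _ | q
  · split_ifs <;> simp [key2, hs]
  · obtain ⟨h1, h2, h3⟩ := strip_eq_some hs
    by_cases h : v = vtx t ℓ i (j + 1)
    · simp [h, key2, hs, h2]
    · simp [h, Ne.symm h, h2]

lemma arE_eq_zero (i : Fin t) {j : ℕ} (h : ℓ i ≤ j) : (arE i j : PathAlg k t ℓ) = 0 := by
  apply Subtype.ext
  apply LinearMap.ext
  intro f
  funext p
  have key2 : ((arE i j : PathAlg k t ℓ) : Module.End k (PSp k t ℓ)) f p =
    (strip i j p).elim 0 f := rfl
  rw [key2]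
  rcases hs : strip i j p with _ | q
  · rfl
  · exact absurd (strip_eq_some hs).2.2 (by omega)

lemma subE_self (i : Fin t) (a : ℕ) : (subE i a a : PathAlg k t ℓ) = 1 := by
  simp [subE]

lemma subE_eq_arE_mul (i : Fin t) {a b : ℕ} (h : a < b) :
    (subE i a b : PathAlg k t ℓ) = arE i a * subE i (a + 1) b := by
  unfold subE
  obtain ⟨n, rfl⟩ : ∃ n, b = a + 1 + n := ⟨b - (a + 1), by omega⟩
  rw [show a + 1 + n - a = n + 1 by omega, show a + 1 + n - (a + 1) = n by omega,
    List.range_succ_eq_map]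
  simp [Function.comp_def, add_assoc, add_comm 1]

lemma subE_succ (i : Fin t) (a : ℕ) : (subE i a (a + 1) : PathAlg k t ℓ) = arE i a := by
  rw [subE_eq_arE_mul i (Nat.lt_succ_self a), subE_self, mul_one]

lemma subE_mul_subE (i : Fin t) {a b c : ℕ} (h : a ≤ b) (h' : b ≤ c) :
    (subE i a b * subE i b c : PathAlg k t ℓ) = subE i a c := by
  induction h using Nat.decreasingInduction with
  | self => rw [subE_self, one_mul]
  | of_succ j hj ih =>
    rw [subE_eq_arE_mul i hj, mul_assoc, ih, ← subE_eq_arE_mul i (by omega)]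

lemma subE_mul_arE (i : Fin t) {a b : ℕ} (h : a ≤ b) :
    (subE i a b * arE i b : PathAlg k t ℓ) = subE i a (b + 1) := by
  rw [← subE_succ, subE_mul_subE i h (by omega)]

lemma eV_mul_subE (v : Vtx t ℓ) (i : Fin t) {a b : ℕ} (h : a < b) :
    (eV v * subE i a b : PathAlg k t ℓ) = if v = vtx t ℓ i a then subE i a b else 0 := by
  rw [subE_eq_arE_mul i h, ← mul_assoc, eV_mul_arE]
  split_ifs <;> simp

lemma subE_mul_eV (v : Vtx t ℓ) (i : Fin t) {a b : ℕ} (h : a < b) :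
    (subE i a b * eV v : PathAlg k t ℓ) = if v = vtx t ℓ i b then subE i a b else 0 := by
  obtain ⟨c, rfl⟩ : ∃ c, b = c + 1 := ⟨b - 1, by omega⟩
  rw [← subE_mul_arE i (by omega : a ≤ c), mul_assoc, arE_mul_eV]
  split_ifs <;> simp

lemma arE_mul_subE (i i' : Fin t) (j : ℕ) {a b : ℕ} (h : a < b) (hb : b ≤ ℓ i') :
    (arE i j * subE i' a b : PathAlg k t ℓ) =
      if i' = i ∧ a = j + 1 then subE i j b else 0 := by
  split_ifs with h1
  · obtain ⟨rfl, rfl⟩ := h1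
    rw [← subE_eq_arE_mul _ (by omega)]
  · have h2 : (subE i' a b : PathAlg k t ℓ) = eV (vtx t ℓ i' a) * subE i' a b := by
      rw [eV_mul_subE _ _ h, if_pos rfl]
    rw [h2, ← mul_assoc, arE_mul_eV, if_neg, zero_mul]
    intro h3
    exact h1 (vtx_inj (by omega) (by omega) h3)

variable (k) in
/-- A path, as an element of the path algebra. -/
def pathE : PIdx t ℓ → PathAlg k t ℓ
  | .vert v => eV v
  | .sub i a b _ _ => subE i a b

lemma pathAlg_induction {P : PathAlg k t ℓ → Prop} (hV : ∀ v, P (eV v)) (hA : ∀ i j, P (arE i j))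
    (hc : ∀ c, P (algebraMap k _ c)) (hadd : ∀ x y, P x → P y → P (x + y))
    (hmul : ∀ x y, P x → P y → P (x * y)) (x : PathAlg k t ℓ) : P x := by
  obtain ⟨x, hx⟩ := x
  refine Algebra.adjoin_induction (p := fun z hz => P ⟨z, hz⟩) ?_ ?_ ?_ ?_ hx
  · rintro _ (⟨v, rfl⟩ | ⟨i, j, rfl⟩)
    · exact hV v
    · exact hA i j
  · exact hc
  · exact fun x y hx hy => hadd ⟨x, hx⟩ ⟨y, hy⟩
  · exact fun x y hx hy => hmul ⟨x, hx⟩ ⟨y, hy⟩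

lemma pathE_mem_span (p : PIdx t ℓ) : pathE k p ∈ Submodule.span k (Set.range (pathE k)) :=
  Submodule.subset_span ⟨p, rfl⟩

lemma eV_mul_pathE_mem_span (v : Vtx t ℓ) (p : PIdx t ℓ) :
    eV v * pathE k p ∈ Submodule.span k (Set.range (pathE k)) := by
  have h0 : eV v * pathE k p = if v = startIdx p then pathE k p else 0 := by
    rcases p with w | ⟨i, a, b, hab, hb⟩
    · change eV v * eV w = if v = startIdx (.vert w) then eV w else 0
      by_cases h : v = w
      · rw [eV_mul_eV, if_pos h, if_pos (show v = startIdx (.vert w) from h), h]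
      · rw [eV_mul_eV, if_neg h, if_neg (show ¬ v = startIdx (.vert w) from h)]
    · exact eV_mul_subE _ _ hab
  rw [h0]
  split_ifs
  exacts [pathE_mem_span p, zero_mem _]

lemma arE_mul_pathE_mem_span (i : Fin t) (j : ℕ) (p : PIdx t ℓ) :
    arE i j * pathE k p ∈ Submodule.span k (Set.range (pathE k)) := by
  by_cases hj : j < ℓ i
  · rcases p with w | ⟨i', a, b, hab, hb⟩
    · simp only [pathE]
      rw [arE_mul_eV]
      split_ifs
      · rw [← subE_succ]
        exact pathE_mem_span (.sub i j (j + 1) (by omega) (by omega))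
      · exact zero_mem _
    · simp only [pathE]
      rw [arE_mul_subE _ _ _ hab hb]
      split_ifs with h
      · obtain ⟨rfl, rfl⟩ := h
        exact pathE_mem_span (.sub i' j b (by omega) hb)
      · exact zero_mem _
  · rw [arE_eq_zero i (by omega), zero_mul]
    exact zero_mem _

/-- A submodule is stable under left multiplication by `x` as soon as `x` maps a spanning set
into it. -/
lemma mul_mem_span_of_forall {S : Set (PathAlg k t ℓ)} {x : PathAlg k t ℓ}
    (h : ∀ z ∈ S, x * z ∈ Submodule.span k S) :
    ∀ y ∈ Submodule.span k S, x * y ∈ Submodule.span k S := fun _ hy =>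
  (Submodule.span_le (p := (Submodule.span k S).comap (LinearMap.mulLeft k x))).2 h hy

lemma mem_span_pathE (x : PathAlg k t ℓ) : x ∈ Submodule.span k (Set.range (pathE k)) := by
  have key : ∀ y ∈ Submodule.span k (Set.range (pathE k)),
      x * y ∈ Submodule.span k (Set.range (pathE k)) := by
    induction x using pathAlg_induction with
    | hV v =>
      apply mul_mem_span_of_forall
      rintro _ ⟨p, rfl⟩
      exact eV_mul_pathE_mem_span v p
    | hA i j =>
      apply mul_mem_span_of_forall
      rintro _ ⟨p, rfl⟩
      exact arE_mul_pathE_mem_span i j p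
    | hc c =>
      intro y hy
      rw [← Algebra.smul_def]
      exact Submodule.smul_mem _ _ hy
    | hadd x y hx hy =>
      intro w hw
      rw [add_mul]
      exact add_mem (hx w hw) (hy w hw)
    | hmul x y hx hy =>
      intro w hw
      rw [mul_assoc]
      exact hx _ (hy w hw)
  have h1 : (1 : PathAlg k t ℓ) ∈ Submodule.span k (Set.range (pathE k)) := by
    rw [← sum_eV]
    exact Submodule.sum_mem _ fun v _ => pathE_mem_span (.vert v)
  simpa using key 1 h1

/-- A linear identity on the path algebra may be checked on paths. -/
lemma linearMap_ext_pathE {M : Type*} [AddCommGroup M] [Module k M]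
    {f g : PathAlg k t ℓ →ₗ[k] M} (h : ∀ p, f (pathE k p) = g (pathE k p)) : f = g := by
  apply LinearMap.ext_on_range (v := pathE k)
  · rw [eq_top_iff]; exact fun x _ => mem_span_pathE x
  · exact h

variable (k) in
/-- The sum of all trivial paths, as a vector of the space of paths. -/
def vertSum : PSp k t ℓ
  | .vert _ => 1
  | .sub _ _ _ _ _ => 0

/-- The coefficient of a path in an element of the path algebra. -/
def coef (p : PIdx t ℓ) : PathAlg k t ℓ →ₗ[k] k where
  toFun x := x.1 (vertSum k) p
  map_add' _ _ := rfl
  map_smul' _ _ := rfl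

lemma coef_eV (v : Vtx t ℓ) (p : PIdx t ℓ) :
    coef p (eV v : PathAlg k t ℓ) = if p = .vert v then 1 else 0 := by
  change (if startIdx p = v then vertSum k p else 0) = _
  rcases p with w | ⟨i, a, b, hab, hb⟩
  · by_cases h : w = v <;> simp [vertSum, startIdx, h]
  · simp [vertSum]

lemma coef_one (p : PIdx t ℓ) : coef p (1 : PathAlg k t ℓ) = vertSum k p := rfl

lemma coef_arE_mul (i : Fin t) (j : ℕ) (x : PathAlg k t ℓ) (p : PIdx t ℓ) :
    coef p (arE i j * x) = (strip i j p).elim 0 (fun q => coef q x) := rfl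

lemma coef_subE (i : Fin t) {a b : ℕ} (hab : a < b) (hb : b ≤ ℓ i) (p : PIdx t ℓ) :
    coef p (subE i a b : PathAlg k t ℓ) = if p = .sub i a b hab hb then 1 else 0 := by
  obtain ⟨n, hn⟩ : ∃ n, n = b - (a + 1) := ⟨_, rfl⟩
  induction n generalizing a p with
  | zero =>
    obtain rfl : b = a + 1 := by omega
    rw [subE_eq_arE_mul i hab, coef_arE_mul, subE_self]
    simp only [coef_one]
    rcases p with w | ⟨i', a', b', hab', hb'⟩
    · simp [strip]
    · simp only [strip, PIdx.sub.injEq]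
      by_cases h : i' = i ∧ a' = a
      · obtain ⟨rfl, rfl⟩ := h
        by_cases h2 : a' + 1 < b'
        · simp [h2, vertSum, h2.ne']
        · simp [vertSum, show b' = a' + 1 by omega]
      · rw [dif_neg h, if_neg (fun h' => h ⟨h'.1, h'.2.1⟩)]
        rfl
  | succ n ih =>
    rw [subE_eq_arE_mul i hab, coef_arE_mul]
    have ih' := fun q => ih (a := a + 1) (p := q) (by omega) (by omega)
    rcases p with w | ⟨i', a', b', hab', hb'⟩
    · simp [strip]
    · simp only [strip, PIdx.sub.injEq]
      by_cases h : i' = i ∧ a' = a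
      · obtain ⟨rfl, rfl⟩ := h
        by_cases h2 : a' + 1 < b'
        · simp only [h2, and_self, dite_true, Option.elim_some, ih', PIdx.sub.injEq, true_and]
        · simp only [h2, and_self, dite_true, dite_false, Option.elim_some, ih',
            true_and, reduceCtorEq, if_false]
          rw [if_neg (by omega)]
      · rw [dif_neg h, if_neg (fun h' => h ⟨h'.1, h'.2.1⟩)]
        rfl

lemma coef_pathE (p q : PIdx t ℓ) : coef p (pathE k q) = if p = q then 1 else 0 := by
  rcases q with v | ⟨i, a, b, hab, hb⟩
  · exact coef_eV v p
  · exact coef_subE i hab hb p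

/-- Every element of the path algebra is the combination of the paths with its coefficients. -/
lemma sum_coef_smul_pathE (x : PathAlg k t ℓ) : ∑ p, coef p x • pathE k p = x := by
  have : (∑ p, (coef p : PathAlg k t ℓ →ₗ[k] k).smulRight (pathE k p)) = LinearMap.id := by
    refine linearMap_ext_pathE (M := PathAlg k t ℓ) fun q => ?_
    simp [LinearMap.sum_apply, coef_pathE]
  simpa [LinearMap.sum_apply] using LinearMap.congr_fun this x

end PathAlgebra

end Toupie

namespace Toupie

section Hereditary

/-- The kernel of a surjection from a projective onto `M` is projective as soon as this holds for
one such surjection. -/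
lemma PdLeOne.projective_ker {R : Type u} [Ring R] {M : ModuleCat.{u} R} (h : PdLeOne R M)
    {Q : Type u} [AddCommGroup Q] [Module R Q] [Module.Projective R Q] (q : Q →ₗ[R] M)
    (hq : Function.Surjective q) : Module.Projective R (LinearMap.ker q) := by
  obtain ⟨P, f, hf, hP, hK⟩ := h
  obtain ⟨s, hs⟩ := Module.projective_lifting_property f q hf
  obtain ⟨r, hr⟩ := Module.projective_lifting_property q f hq
  have hs' : ∀ x, f (s x) = q x := fun x => LinearMap.congr_fun hs x
  have hr' : ∀ x, q (r x) = f x := fun x => LinearMap.congr_fun hr x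
  let i : LinearMap.ker q →ₗ[R] LinearMap.ker f × Q :=
    ((s.comp (LinearMap.ker q).subtype).codRestrict (LinearMap.ker f) (by
      rintro ⟨x, hx⟩
      simpa [hs'] using hx)).prod (LinearMap.ker q).subtype
  let p : LinearMap.ker f × Q →ₗ[R] LinearMap.ker q :=
    ((r.comp (LinearMap.ker f).subtype).coprod (LinearMap.id - r.comp s)).codRestrict
      (LinearMap.ker q) (by
      rintro ⟨⟨x, hx⟩, y⟩
      have hx' : f x = 0 := hx
      simp [hr', hs', hx'])
  refine Module.Projective.of_split i p ?_
  ext ⟨x, hx⟩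
  simp [i, p]

/-- Over a right hereditary ring, the right annihilator of any element is generated by an
element acting on it as the identity. -/
lemma Hereditary.exists_annihilator_generator {A : Type u} [Ring A] (h : Hereditary Aᵐᵒᵖ) (a : A) :
    ∃ g : A, a * g = 0 ∧ ∀ y, a * y = 0 → g * y = y := by
  let φ : A →ₗ[Aᵐᵒᵖ] A :=
    { toFun := fun x => a * x
      map_add' := mul_add a
      map_smul' := fun c x => by simp [MulOpposite.smul_eq_mul_unop, mul_assoc] }
  have hA : Module.Projective Aᵐᵒᵖ A :=
    Module.Projective.of_equiv
      ({ MulOpposite.opAddEquiv.symm with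
          map_smul' := fun c x => by simp [MulOpposite.smul_eq_mul_unop] } : Aᵐᵒᵖ ≃ₗ[Aᵐᵒᵖ] A)
  have hN : Module.Projective Aᵐᵒᵖ (LinearMap.range φ) := by
    have := (h (ModuleCat.of Aᵐᵒᵖ (A ⧸ LinearMap.range φ))).projective_ker
      (LinearMap.range φ).mkQ (Submodule.mkQ_surjective _)
    rwa [Submodule.ker_mkQ] at this
  obtain ⟨σ, hσ⟩ := Module.projective_lifting_property φ.rangeRestrict LinearMap.id
    φ.surjective_rangeRestrict
  have hσ' : ∀ x, a * σ x = x := fun x => congrArg Subtype.val (LinearMap.congr_fun hσ x)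
  refine ⟨1 - σ (φ.rangeRestrict 1), ?_, fun y hy => ?_⟩
  · rw [mul_sub, hσ', mul_one]
    simp [φ]
  · have h1 : σ (φ.rangeRestrict 1) * y = σ (φ.rangeRestrict y) := by
      have : φ.rangeRestrict y = op y • φ.rangeRestrict 1 := by
        rw [← map_smul]; simp
      rw [this, map_smul]
      simp
    have h2 : φ.rangeRestrict y = 0 := Subtype.ext hy
    rw [sub_mul, one_mul, h1, h2, map_zero, sub_zero]

end Hereditary

section Quasifree

open scoped TensorProduct

variable (k : Type u) [Field k]

/-- The bar differential `x ⊗ y ⊗ z ↦ x y ⊗ z - x ⊗ y z`. -/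
def barMap (R : Type u) [Ring R] [Algebra k R] : R ⊗[k] (R ⊗[k] R) →ₗ[k] R ⊗[k] R :=
  TensorProduct.map (LinearMap.mul' k R) LinearMap.id ∘ₗ
      (TensorProduct.assoc k R R R).symm.toLinearMap -
    TensorProduct.map LinearMap.id (LinearMap.mul' k R)

lemma barMap_tmul {R : Type u} [Ring R] [Algebra k R] (x y z : R) :
    barMap k R (x ⊗ₜ (y ⊗ₜ z)) = (x * y) ⊗ₜ z - x ⊗ₜ (y * z) := by
  simp [barMap]

/-- A derivation `d : R → R ⊗ R ⊗ R` whose composite with the bar differential is the universal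
derivation `a ↦ a ⊗ 1 - 1 ⊗ a`. -/
structure IsBarSplitting {R : Type u} [Ring R] [Algebra k R]
    (d : R →ₗ[k] R ⊗[k] (R ⊗[k] R)) : Prop where
  map_mul : ∀ a b, d (a * b) = (a ⊗ₜ (1 ⊗ₜ 1)) * d b + d a * (1 ⊗ₜ (1 ⊗ₜ b))
  barMap_apply : ∀ a, barMap k R (d a) = a ⊗ₜ 1 - 1 ⊗ₜ a

variable {k} {R : Type u} [Ring R] [Algebra k R]

section

variable (M : Type u) [AddCommGroup M] [Module k M] [Module R M] [IsScalarTower k R M]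
  [SMulCommClass R k M]

/-- The action map `R ⊗ M → M`. -/
def actMap : R ⊗[k] M →ₗ[R] M :=
  TensorProduct.AlgebraTensorModule.lift
    { toFun := fun r => { toFun := fun m => r • m
                          map_add' := smul_add r
                          map_smul' := fun c m => smul_comm r c m }
      map_add' := fun r s => by ext m; exact add_smul r s m
      map_smul' := fun r s => by ext m; exact mul_smul r s m }

lemma actMap_tmul (r : R) (m : M) : actMap (k := k) M (r ⊗ₜ m) = r • m := rfl

/-- The map `(x ⊗ y ⊗ z) ⊗ m ↦ x ⊗ y ⊗ z m`. -/
def actLast : (R ⊗[k] (R ⊗[k] R)) ⊗[k] M →ₗ[k] R ⊗[k] (R ⊗[k] M) :=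
  TensorProduct.map LinearMap.id
      (TensorProduct.map LinearMap.id ((actMap (k := k) (R := R) M).restrictScalars k) ∘ₗ
        (TensorProduct.assoc k R R M).toLinearMap) ∘ₗ
    (TensorProduct.assoc k R (R ⊗[k] R) M).toLinearMap

lemma actLast_tmul (x y z : R) (m : M) :
    actLast (k := k) M ((x ⊗ₜ (y ⊗ₜ z)) ⊗ₜ m) = x ⊗ₜ (y ⊗ₜ (z • m)) := rfl

/-- The map `x ⊗ y ⊗ m ↦ x y ⊗ m - x ⊗ y m`. -/
def barModule : R ⊗[k] (R ⊗[k] M) →ₗ[R] R ⊗[k] M :=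
  actMap (k := k) (R := R) (R ⊗[k] M) -
    TensorProduct.AlgebraTensorModule.map LinearMap.id
      ((actMap (k := k) (R := R) M).restrictScalars k)

lemma barModule_tmul (x y : R) (m : M) :
    barModule (k := k) M (x ⊗ₜ (y ⊗ₜ m)) = (x * y) ⊗ₜ m - x ⊗ₜ (y • m) := rfl

variable {M}

lemma actMap_barModule (w : R ⊗[k] (R ⊗[k] M)) :
    actMap (k := k) (R := R) M (barModule (k := k) M w) = 0 := by
  induction w with
  | zero => simp
  | add x y hx hy => simp [hx, hy]
  | tmul x w =>
    induction w with
    | zero => simp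
    | add x y hx hy => rw [TensorProduct.tmul_add, map_add, map_add, hx, hy, add_zero]
    | tmul y m => rw [barModule_tmul, map_sub, actMap_tmul, actMap_tmul, mul_smul, sub_self]

/-- Induction on pure tensors in a threefold tensor product. -/
lemma tensor_induction {P : R ⊗[k] (R ⊗[k] R) → Prop} (h0 : P 0)
    (hadd : ∀ x y, P x → P y → P (x + y)) (h : ∀ x y z, P (x ⊗ₜ (y ⊗ₜ z))) (w) : P w := by
  induction w with
  | zero => exact h0
  | add x y hx hy => exact hadd x y hx hy
  | tmul x w =>
    induction w with
    | zero => rw [TensorProduct.tmul_zero]; exact h0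
    | add y z hy hz => rw [TensorProduct.tmul_add]; exact hadd _ _ hy hz
    | tmul y z => exact h x y z

lemma actLast_left (a : R) (w : R ⊗[k] (R ⊗[k] R)) (m : M) :
    actLast (k := k) M (((a ⊗ₜ (1 ⊗ₜ 1)) * w) ⊗ₜ m) = a • actLast (k := k) M (w ⊗ₜ m) := by
  induction w using tensor_induction with
  | h0 => simp
  | hadd x y hx hy => rw [mul_add, TensorProduct.add_tmul, map_add, hx, hy, TensorProduct.add_tmul,
      map_add, smul_add]
  | h x y z =>
    simp only [Algebra.TensorProduct.tmul_mul_tmul, one_mul, actLast_tmul]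
    rfl

lemma actLast_right (b : R) (w : R ⊗[k] (R ⊗[k] R)) (m : M) :
    actLast (k := k) M ((w * (1 ⊗ₜ (1 ⊗ₜ b))) ⊗ₜ m) = actLast (k := k) M (w ⊗ₜ (b • m)) := by
  induction w using tensor_induction with
  | h0 => simp
  | hadd x y hx hy => rw [add_mul, TensorProduct.add_tmul, map_add, hx, hy, TensorProduct.add_tmul,
      map_add]
  | h x y z =>
    simp only [Algebra.TensorProduct.tmul_mul_tmul, mul_one, actLast_tmul, mul_smul]

lemma barModule_actLast (w : R ⊗[k] (R ⊗[k] R)) (m : M) :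
    barModule (k := k) M (actLast (k := k) M (w ⊗ₜ m)) =
      TensorProduct.map LinearMap.id ((actMap (k := k) (R := R) M).restrictScalars k)
        (TensorProduct.assoc k R R M (barMap k R w ⊗ₜ m)) := by
  induction w using tensor_induction with
  | h0 => simp
  | hadd x y hx hy =>
    rw [TensorProduct.add_tmul, map_add, map_add, hx, hy, map_add, TensorProduct.add_tmul, map_add,
      map_add]
  | h x y z =>
    rw [actLast_tmul, barModule_tmul, barMap_tmul, TensorProduct.sub_tmul, map_sub, map_sub]
    simp [actMap_tmul, mul_smul]

/-- A bar splitting makes the kernel of the action map `R ⊗ M → M` projective. -/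
lemma IsBarSplitting.projective_ker {d : R →ₗ[k] R ⊗[k] (R ⊗[k] R)} (hd : IsBarSplitting k d) :
    Module.Projective R (LinearMap.ker (actMap (k := k) (R := R) M)) := by
  let Ψ : R ⊗[k] M →ₗ[k] R ⊗[k] (R ⊗[k] M) := actLast M ∘ₗ TensorProduct.map d LinearMap.id
  have hΨ : ∀ r (m : M), Ψ (r ⊗ₜ m) = actLast (k := k) M (d r ⊗ₜ m) := fun r m => rfl
  have hsmul : ∀ (b : R) (x : R ⊗[k] M),
      Ψ (b • x) = b • Ψ x + actLast (k := k) M (d b ⊗ₜ actMap (k := k) M x) := by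
    intro b x
    induction x with
    | zero => simp
    | add x y hx hy =>
      rw [smul_add, map_add, hx, hy, map_add, smul_add, map_add, TensorProduct.tmul_add, map_add]
      abel
    | tmul r m =>
      rw [TensorProduct.smul_tmul', smul_eq_mul, hΨ, hΨ, hd.map_mul, TensorProduct.add_tmul,
        map_add, actLast_left, actLast_right, actMap_tmul]
  have hbar : ∀ x : R ⊗[k] M, barModule (k := k) M (Ψ x) = x - 1 ⊗ₜ actMap (k := k) M x := by
    intro x
    induction x with
    | zero => simp
    | add x y hx hy =>
      rw [map_add, map_add, hx, hy, map_add, TensorProduct.tmul_add]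
      abel
    | tmul r m =>
      rw [hΨ, barModule_actLast, hd.barMap_apply, TensorProduct.sub_tmul, map_sub, map_sub]
      simp [actMap_tmul]
  let i : LinearMap.ker (actMap (k := k) (R := R) M) →ₗ[R] R ⊗[k] (R ⊗[k] M) :=
    { toFun := fun x => Ψ x.1
      map_add' := fun x y => map_add Ψ _ _
      map_smul' := fun b x => by
        have hx : actMap (k := k) M x.1 = 0 := x.2
        simp [hsmul, hx] }
  let p : R ⊗[k] (R ⊗[k] M) →ₗ[R] LinearMap.ker (actMap (k := k) (R := R) M) :=
    (barModule (k := k) M).codRestrict _ actMap_barModule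
  refine Module.Projective.of_split i p ?_
  ext ⟨x, hx⟩
  have hx' : actMap (k := k) M x = 0 := hx
  change barModule (k := k) M (Ψ x) = x
  rw [hbar, hx', TensorProduct.tmul_zero, sub_zero]

end

lemma IsBarSplitting.hereditary {d : R →ₗ[k] R ⊗[k] (R ⊗[k] R)} (hd : IsBarSplitting k d) :
    Hereditary R := by
  intro M
  let _ : Module k M := Module.compHom M (algebraMap k R)
  have hs : ∀ (c : k) (m : M), c • m = algebraMap k R c • m := fun _ _ => rfl
  have : IsScalarTower k R M := ⟨fun c r m => by rw [hs, Algebra.smul_def, mul_smul]⟩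
  have : SMulCommClass R k M := ⟨fun r c m => by
    rw [hs, hs, ← mul_smul, ← mul_smul, Algebra.commutes]⟩
  refine ⟨ModuleCat.of R (R ⊗[k] M), actMap (k := k) M, fun m => ⟨1 ⊗ₜ m, one_smul R m⟩, ?_,
    hd.projective_ker⟩
  change Module.Projective R (R ⊗[k] M)
  infer_instance

/-- A bar splitting of an algebra induces one of any anti-isomorphic algebra. -/
lemma IsBarSplitting.of_antiEquiv {B : Type u} [Ring B] [Algebra k B]
    {d : B →ₗ[k] B ⊗[k] (B ⊗[k] B)} (hd : IsBarSplitting k d) (ε : B ≃ₗ[k] R)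
    (h1 : ε 1 = 1) (hmul : ∀ x y, ε (x * y) = ε y * ε x) :
    ∃ d' : R →ₗ[k] R ⊗[k] (R ⊗[k] R), IsBarSplitting k d' := by
  let Θ : B ⊗[k] (B ⊗[k] B) →ₗ[k] R ⊗[k] (R ⊗[k] R) :=
    TensorProduct.map ε.toLinearMap (TensorProduct.map ε.toLinearMap ε.toLinearMap) ∘ₗ
      (TensorProduct.assoc k B B B).toLinearMap ∘ₗ
      TensorProduct.map (TensorProduct.comm k B B).toLinearMap LinearMap.id ∘ₗ
      (TensorProduct.comm k B (B ⊗[k] B)).toLinearMap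
  have hΘ : ∀ x y z, Θ (x ⊗ₜ (y ⊗ₜ z)) = ε z ⊗ₜ (ε y ⊗ₜ ε x) := fun _ _ _ => rfl
  have hl : ∀ a w, Θ ((a ⊗ₜ (1 ⊗ₜ 1)) * w) = Θ w * (1 ⊗ₜ (1 ⊗ₜ ε a)) := by
    intro a w
    induction w using tensor_induction with
    | h0 => simp
    | hadd x y hx hy => rw [mul_add, map_add, hx, hy, map_add, add_mul]
    | h x y z => simp only [Algebra.TensorProduct.tmul_mul_tmul, one_mul, mul_one, hΘ, hmul]
  have hr : ∀ a w, Θ (w * (1 ⊗ₜ (1 ⊗ₜ a))) = (ε a ⊗ₜ (1 ⊗ₜ 1)) * Θ w := by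
    intro a w
    induction w using tensor_induction with
    | h0 => simp
    | hadd x y hx hy => rw [add_mul, map_add, hx, hy, map_add, mul_add]
    | h x y z => simp only [Algebra.TensorProduct.tmul_mul_tmul, one_mul, mul_one, hΘ, hmul]
  let sw : B ⊗[k] B →ₗ[k] R ⊗[k] R :=
    TensorProduct.map ε.toLinearMap ε.toLinearMap ∘ₗ (TensorProduct.comm k B B).toLinearMap
  have hsw : ∀ x y, sw (x ⊗ₜ y) = ε y ⊗ₜ ε x := fun _ _ => rfl
  have hb : ∀ w, barMap k R (Θ w) = -sw (barMap k B w) := by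
    intro w
    induction w using tensor_induction with
    | h0 => simp
    | hadd x y hx hy => rw [map_add, map_add, hx, hy, map_add, map_add, neg_add]
    | h x y z =>
      rw [hΘ, barMap_tmul, barMap_tmul, map_sub, hsw, hsw, hmul, hmul, neg_sub]
  refine ⟨Θ ∘ₗ d ∘ₗ ε.symm.toLinearMap, ⟨fun a b => ?_, fun a => ?_⟩⟩
  · obtain ⟨a, rfl⟩ := ε.surjective a
    obtain ⟨b, rfl⟩ := ε.surjective b
    simp only [← hmul, LinearMap.comp_apply, LinearEquiv.coe_coe, LinearEquiv.symm_apply_apply]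
    rw [hd.map_mul, map_add, hl, hr, add_comm]
  · obtain ⟨a, rfl⟩ := ε.surjective a
    simp only [LinearMap.comp_apply, LinearEquiv.coe_coe, LinearEquiv.symm_apply_apply]
    rw [hb, hd.barMap_apply, map_sub, hsw, hsw, h1, neg_sub]

end Quasifree

end Toupie

namespace Toupie

section PathAlgebraHereditary

open scoped TensorProduct

variable {k : Type u} [Field k] {t : ℕ} {ℓ : Fin t → ℕ}

lemma pathE_induction {P : PathAlg k t ℓ → Prop} (h0 : P 0) (hadd : ∀ x y, P x → P y → P (x + y))
    (hsmul : ∀ (c : k) x, P x → P (c • x)) (hp : ∀ p, P (pathE k p)) (x : PathAlg k t ℓ) : P x := by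
  refine Submodule.span_induction (p := fun x _ => P x) ?_ h0 (fun x y _ _ => hadd x y)
    (fun c x _ => hsmul c x) (mem_span_pathE x)
  rintro _ ⟨p, rfl⟩
  exact hp p

/-- The path along branch `i` from position `a` to position `b ≥ a`, which is the trivial path if
`a = b`. -/
def seg (i : Fin t) (a b : ℕ) : PathAlg k t ℓ := eV (vtx t ℓ i a) * subE i a b

lemma seg_self (i : Fin t) (a : ℕ) : (seg i a a : PathAlg k t ℓ) = eV (vtx t ℓ i a) := by
  rw [seg, subE_self, mul_one]

lemma seg_of_lt (i : Fin t) {a b : ℕ} (h : a < b) : (seg i a b : PathAlg k t ℓ) = subE i a b := by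
  rw [seg, eV_mul_subE _ _ h, if_pos rfl]

lemma eV_mul_seg (v : Vtx t ℓ) (i : Fin t) (a b : ℕ) :
    (eV v * seg i a b : PathAlg k t ℓ) = if v = vtx t ℓ i a then seg i a b else 0 := by
  rw [seg, ← mul_assoc, eV_mul_eV]
  by_cases h : v = vtx t ℓ i a
  · rw [if_pos h, if_pos h, h]
  · rw [if_neg h, if_neg h, zero_mul]

lemma seg_mul_arE (i : Fin t) {a b : ℕ} (h : a ≤ b) :
    (seg i a b * arE i b : PathAlg k t ℓ) = seg i a (b + 1) := by
  rw [seg, mul_assoc, subE_mul_arE i h, seg]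

lemma arE_mul_seg (i : Fin t) {a b : ℕ} (h : a < b) :
    (arE i a * seg i (a + 1) b : PathAlg k t ℓ) = seg i a b := by
  rw [seg, ← mul_assoc, arE_mul_eV, if_pos rfl, ← subE_eq_arE_mul i h, seg_of_lt i h]

lemma arE_mul_seg_of_ne {i i' : Fin t} {j a : ℕ} (b : ℕ) (h : vtx t ℓ i' a ≠ vtx t ℓ i (j + 1)) :
    (arE i j * seg i' a b : PathAlg k t ℓ) = 0 := by
  rw [seg, ← mul_assoc, arE_mul_eV, if_neg h, zero_mul]

variable {B : Type u} [Ring B] [Algebra k B] (φ : PathAlg k t ℓ →ₐ[k] B)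

/-- The sum over all arrows `α` of a path `p = q α r` of the images of the tensors `q ⊗ α ⊗ r`. -/
def pathDeriv : PIdx t ℓ → B ⊗[k] (B ⊗[k] B)
  | .vert _ => 0
  | .sub i a b _ _ =>
    ∑ s ∈ Finset.Ico a b, φ (seg i a s) ⊗ₜ[k] (φ (arE i s) ⊗ₜ[k] φ (seg i (s + 1) b))

/-- The linear extension of `pathDeriv`. -/
def deriv : PathAlg k t ℓ →ₗ[k] B ⊗[k] (B ⊗[k] B) :=
  ∑ p, (coef p).smulRight (pathDeriv φ p)

lemma deriv_pathE (p : PIdx t ℓ) : deriv φ (pathE k p) = pathDeriv φ p := by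
  simp [deriv, LinearMap.sum_apply, coef_pathE]

lemma deriv_eV (v : Vtx t ℓ) : deriv φ (eV v) = 0 := deriv_pathE φ (.vert v)

lemma deriv_subE (i : Fin t) {a b : ℕ} (h : a < b) (hb : b ≤ ℓ i) :
    deriv φ (subE i a b) =
      ∑ s ∈ Finset.Ico a b, φ (seg i a s) ⊗ₜ[k] (φ (arE i s) ⊗ₜ[k] φ (seg i (s + 1) b)) :=
  deriv_pathE φ (.sub i a b h hb)

lemma deriv_arE (i : Fin t) {j : ℕ} (h : j < ℓ i) :
    deriv φ (arE i j) =
      φ (eV (vtx t ℓ i j)) ⊗ₜ[k] (φ (arE i j) ⊗ₜ[k] φ (eV (vtx t ℓ i (j + 1)))) := by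
  rw [← subE_succ, deriv_subE φ i (Nat.lt_succ_self j) h]
  simp [seg_self, subE_succ]

lemma deriv_eV_mul (v : Vtx t ℓ) (x : PathAlg k t ℓ) :
    deriv φ (eV v * x) = (φ (eV v) ⊗ₜ[k] (1 ⊗ₜ[k] 1)) * deriv φ x := by
  induction x using pathE_induction with
  | h0 => simp
  | hadd x y hx hy => rw [mul_add, map_add, hx, hy, map_add, mul_add]
  | hsmul c x hx => rw [mul_smul_comm, map_smul, hx, map_smul, mul_smul_comm]
  | hp p =>
    rcases p with w | ⟨i, a, b, hab, hb⟩
    · simp only [pathE]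
      rw [eV_mul_eV, deriv_eV, mul_zero]
      split_ifs
      · exact deriv_eV φ v
      · exact map_zero _
    · simp only [pathE]
      rw [eV_mul_subE _ _ hab, deriv_subE φ i hab hb, Finset.mul_sum]
      simp only [Algebra.TensorProduct.tmul_mul_tmul, one_mul, ← map_mul, eV_mul_seg]
      split_ifs
      · exact deriv_subE φ i hab hb
      · simp

lemma deriv_arE_mul (i : Fin t) (j : ℕ) (x : PathAlg k t ℓ) :
    deriv φ (arE i j * x) =
      (φ (arE i j) ⊗ₜ[k] (1 ⊗ₜ[k] 1)) * deriv φ x + deriv φ (arE i j) * (1 ⊗ₜ[k] (1 ⊗ₜ[k] φ x)) := by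
  by_cases hj : j < ℓ i
  swap
  · rw [arE_eq_zero i (by omega)]
    simp
  rw [deriv_arE φ i hj, Algebra.TensorProduct.tmul_mul_tmul, Algebra.TensorProduct.tmul_mul_tmul,
    mul_one, mul_one, ← map_mul]
  induction x using pathE_induction with
  | h0 => simp
  | hadd x y hx hy =>
    rw [mul_add, map_add, hx, hy, map_add, mul_add, mul_add, map_add, TensorProduct.tmul_add,
      TensorProduct.tmul_add]
    abel
  | hsmul c x hx =>
    rw [mul_smul_comm, map_smul, hx, map_smul, mul_smul_comm, mul_smul_comm, map_smul,
      TensorProduct.tmul_smul, TensorProduct.tmul_smul, smul_add]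
  | hp p =>
    rcases p with w | ⟨i', a, b, hab, hb⟩
    · simp only [pathE]
      rw [arE_mul_eV, deriv_eV, mul_zero, zero_add, eV_mul_eV]
      by_cases h : w = vtx t ℓ i (j + 1)
      · rw [if_pos h, if_pos h.symm, deriv_arE φ i hj]
      · rw [if_neg h, if_neg (Ne.symm h)]
        simp
    · simp only [pathE]
      rw [deriv_subE φ _ hab hb, Finset.mul_sum]
      simp only [Algebra.TensorProduct.tmul_mul_tmul, one_mul, ← map_mul]
      by_cases h : vtx t ℓ i' a = vtx t ℓ i (j + 1)
      · obtain ⟨rfl, rfl⟩ := vtx_inj (by omega) (by omega) h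
        rw [← subE_eq_arE_mul _ (by omega), deriv_subE φ _ (by omega) hb, ← seg_of_lt _ hab,
          eV_mul_seg, if_pos rfl, Finset.sum_eq_sum_Ico_succ_bot (by omega), seg_self, add_comm]
        congr 1
        refine Finset.sum_congr rfl fun s hs => ?_
        have hs' := Finset.mem_Ico.1 hs
        rw [arE_mul_seg i' (by omega)]
      · rw [← seg_of_lt _ hab, eV_mul_seg, if_neg (Ne.symm h), arE_mul_seg_of_ne _ h]
        simp [arE_mul_seg_of_ne _ h]

lemma deriv_mul (x y : PathAlg k t ℓ) :
    deriv φ (x * y) =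
      (φ x ⊗ₜ[k] (1 ⊗ₜ[k] 1)) * deriv φ y + deriv φ x * (1 ⊗ₜ[k] (1 ⊗ₜ[k] φ y)) := by
  induction x using pathAlg_induction generalizing y with
  | hV v => rw [deriv_eV, zero_mul, add_zero, deriv_eV_mul]
  | hA i j => exact deriv_arE_mul φ i j y
  | hc c =>
    have h1 : deriv φ 1 = 0 := by
      rw [← sum_eV, map_sum]
      exact Finset.sum_eq_zero fun v _ => deriv_eV φ v
    have h2 : deriv φ (c • 1) = 0 := by rw [map_smul, h1, smul_zero]
    rw [Algebra.algebraMap_eq_smul_one, h2, zero_mul, add_zero, smul_mul_assoc, one_mul, map_smul,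
      map_smul, map_one, ← TensorProduct.smul_tmul', smul_mul_assoc]
    congr 1
    exact (one_mul _).symm
  | hadd x x' hx hx' =>
    rw [add_mul, map_add, hx, hx', map_add, TensorProduct.add_tmul, map_add, add_mul, add_mul]
    abel
  | hmul x x' hx hx' =>
    have e1 : φ (x * x') ⊗ₜ[k] ((1 : B) ⊗ₜ[k] (1 : B)) =
        (φ x ⊗ₜ[k] (1 ⊗ₜ[k] 1)) * (φ x' ⊗ₜ[k] (1 ⊗ₜ[k] 1)) := by simp
    have e2 : (1 : B) ⊗ₜ[k] ((1 : B) ⊗ₜ[k] φ (x' * y)) =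
        (1 ⊗ₜ[k] (1 ⊗ₜ[k] φ x')) * (1 ⊗ₜ[k] (1 ⊗ₜ[k] φ y)) := by simp
    rw [mul_assoc, hx, hx', hx x', e1, e2, mul_add, add_mul, mul_assoc, mul_assoc, mul_assoc,
      add_assoc]

lemma barMap_deriv (x : PathAlg k t ℓ) :
    barMap k B (deriv φ x) =
      ∑ v, ((φ x * φ (eV v)) ⊗ₜ[k] φ (eV v) - φ (eV v) ⊗ₜ[k] (φ (eV v) * φ x)) := by
  induction x using pathE_induction with
  | h0 => simp
  | hadd x y hx hy =>
    rw [map_add, map_add, hx, hy, ← Finset.sum_add_distrib]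
    refine Finset.sum_congr rfl fun v _ => ?_
    rw [map_add, add_mul, mul_add, TensorProduct.add_tmul, TensorProduct.tmul_add]
    abel
  | hsmul c x hx =>
    rw [map_smul, map_smul, hx, Finset.smul_sum]
    refine Finset.sum_congr rfl fun v _ => ?_
    rw [map_smul, smul_mul_assoc, mul_smul_comm, TensorProduct.tmul_smul,
      ← TensorProduct.smul_tmul', smul_sub]
  | hp p =>
    rcases p with w | ⟨i, a, b, hab, hb⟩
    · simp only [pathE]
      rw [deriv_eV, map_zero]
      refine (Finset.sum_eq_zero fun v _ => ?_).symm
      rw [← map_mul, ← map_mul, eV_mul_eV, eV_mul_eV]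
      by_cases h : v = w
      · rw [if_pos h, if_pos h.symm, h, sub_self]
      · rw [if_neg h, if_neg (Ne.symm h)]
        simp
    · simp only [pathE]
      let f : ℕ → B ⊗[k] B := fun s => φ (seg i a s) ⊗ₜ[k] φ (seg i s b)
      have h1 : ∀ s ∈ Finset.Ico a b,
          barMap k B (φ (seg i a s) ⊗ₜ[k] (φ (arE i s) ⊗ₜ[k] φ (seg i (s + 1) b))) =
          f (s + 1) - f s := by
        intro s hs
        have hs' := Finset.mem_Ico.1 hs
        rw [barMap_tmul, ← map_mul, ← map_mul, seg_mul_arE i (by omega), arE_mul_seg i (by omega)]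
      have h2 : ∀ v : Vtx t ℓ, (φ (subE i a b) * φ (eV v)) ⊗ₜ[k] φ (eV v) =
          if v = vtx t ℓ i b then f b else 0 := fun v => by
        rw [← map_mul, subE_mul_eV _ _ hab]
        by_cases h : v = vtx t ℓ i b
        · rw [if_pos h, if_pos h, h, ← seg_self, ← seg_of_lt i hab]
        · rw [if_neg h, if_neg h, map_zero, TensorProduct.zero_tmul]
      have h3 : ∀ v : Vtx t ℓ, φ (eV v) ⊗ₜ[k] (φ (eV v) * φ (subE i a b)) =
          if v = vtx t ℓ i a then f a else 0 := fun v => by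
        rw [← map_mul, eV_mul_subE _ _ hab]
        by_cases h : v = vtx t ℓ i a
        · rw [if_pos h, if_pos h, h, ← seg_self, ← seg_of_lt i hab]
        · rw [if_neg h, if_neg h, map_zero, TensorProduct.tmul_zero]
      rw [deriv_subE φ i hab hb, map_sum, Finset.sum_congr rfl h1, Finset.sum_Ico_sub f hab.le,
        Finset.sum_sub_distrib, Finset.sum_congr rfl fun v _ => h2 v,
        Finset.sum_congr rfl fun v _ => h3 v, Finset.sum_ite_eq', Finset.sum_ite_eq',
        if_pos (Finset.mem_univ _), if_pos (Finset.mem_univ _)]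

/-- An algebra isomorphic to the path algebra has a bar splitting: the sum of `deriv` and the inner
derivation given by `- ∑ v, 1 ⊗ e_v ⊗ e_v`. -/
lemma exists_isBarSplitting_of_algEquiv (e : PathAlg k t ℓ ≃ₐ[k] B) :
    ∃ d : B →ₗ[k] B ⊗[k] (B ⊗[k] B), IsBarSplitting k d := by
  let ξ : B ⊗[k] (B ⊗[k] B) := ∑ v, 1 ⊗ₜ[k] (e (eV v) ⊗ₜ[k] e (eV v))
  let δ : B →ₗ[k] B ⊗[k] (B ⊗[k] B) :=
    { toFun := fun x => ξ * (1 ⊗ₜ[k] (1 ⊗ₜ[k] x)) - (x ⊗ₜ[k] (1 ⊗ₜ[k] 1)) * ξ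
      map_add' := fun x y => by
        rw [TensorProduct.add_tmul, TensorProduct.tmul_add, TensorProduct.tmul_add, mul_add,
          add_mul]
        abel
      map_smul' := fun c x => by
        rw [TensorProduct.tmul_smul, TensorProduct.tmul_smul, ← TensorProduct.smul_tmul',
          mul_smul_comm, smul_mul_assoc, RingHom.id_apply, smul_sub] }
  have hδ : ∀ x, δ x = ξ * (1 ⊗ₜ[k] (1 ⊗ₜ[k] x)) - (x ⊗ₜ[k] (1 ⊗ₜ[k] 1)) * ξ := fun _ => rfl
  let D : B →ₗ[k] B ⊗[k] (B ⊗[k] B) := deriv (e : PathAlg k t ℓ →ₐ[k] B) ∘ₗ e.symm.toLinearMap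
  have hD : ∀ x, D (e x) = deriv (e : PathAlg k t ℓ →ₐ[k] B) x := fun x =>
    congrArg (deriv (e : PathAlg k t ℓ →ₐ[k] B)) (e.symm_apply_apply x)
  refine ⟨D + δ, ⟨fun x y => ?_, fun x => ?_⟩⟩
  · obtain ⟨x, rfl⟩ := e.surjective x
    obtain ⟨y, rfl⟩ := e.surjective y
    have e1 : (e x * e y) ⊗ₜ[k] ((1 : B) ⊗ₜ[k] (1 : B)) =
        (e x ⊗ₜ[k] (1 ⊗ₜ[k] 1)) * (e y ⊗ₜ[k] (1 ⊗ₜ[k] 1)) := by simp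
    have e2 : (1 : B) ⊗ₜ[k] ((1 : B) ⊗ₜ[k] (e x * e y)) =
        (1 ⊗ₜ[k] (1 ⊗ₜ[k] e x)) * (1 ⊗ₜ[k] (1 ⊗ₜ[k] e y)) := by simp
    have hm : D (e x * e y) = (e x ⊗ₜ[k] (1 ⊗ₜ[k] 1)) * D (e y) +
        D (e x) * (1 ⊗ₜ[k] (1 ⊗ₜ[k] e y)) := by
      rw [← map_mul, hD, hD, hD]
      exact deriv_mul _ x y
    simp only [LinearMap.add_apply]
    rw [hδ, hδ, hδ, hm, e1, e2]
    simp only [mul_add, add_mul, mul_sub, sub_mul, mul_assoc]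
    abel
  · obtain ⟨x, rfl⟩ := e.surjective x
    have h1 : ∀ v : Vtx t ℓ, e (eV v) * e (eV v) = e (eV v) := fun v => by
      rw [← map_mul, eV_mul_eV, if_pos rfl]
    have h0 : ∑ v, e (eV v : PathAlg k t ℓ) = 1 := by rw [← map_sum, sum_eV, map_one]
    have h2 : ∀ x y : B, ∑ v, x ⊗ₜ[k] (e (eV v : PathAlg k t ℓ) * y) = x ⊗ₜ[k] y := fun x y => by
      rw [← TensorProduct.tmul_sum, ← Finset.sum_mul, h0, one_mul]
    have h3 : ∀ x : B, ∑ v, x ⊗ₜ[k] e (eV v : PathAlg k t ℓ) = x ⊗ₜ[k] (1 : B) := fun x => by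
      rw [← TensorProduct.tmul_sum, h0]
    have hb : barMap k B (D (e x)) =
        ∑ v, ((e x * e (eV v)) ⊗ₜ[k] e (eV v) - e (eV v) ⊗ₜ[k] (e (eV v) * e x)) := by
      rw [hD]
      exact barMap_deriv _ x
    simp only [LinearMap.add_apply]
    rw [map_add, hb, hδ, Finset.mul_sum, Finset.sum_mul, map_sub, map_sum, map_sum]
    simp only [Algebra.TensorProduct.tmul_mul_tmul, one_mul, mul_one, barMap_tmul, ← mul_assoc, h1,
      Finset.sum_sub_distrib, h2, h3]
    abel

end PathAlgebraHereditary

end Toupie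

namespace Toupie

section Paths

variable {k : Type u} [Field k] {t : ℕ} {ℓ : Fin t → ℕ}

lemma vtx_eq_src {i : Fin t} {a : ℕ} (h : vtx t ℓ i a = .src) : a = 0 := by
  unfold vtx at h
  split_ifs at h with h1
  exact h1

lemma vtx_eq_snk {i : Fin t} {a : ℕ} (h : vtx t ℓ i a = .snk) : ℓ i ≤ a := by
  unfold vtx at h
  split_ifs at h with h1 h2
  omega

lemma seg_mul_eV (v : Vtx t ℓ) (i : Fin t) {a b : ℕ} (h : a ≤ b) :
    (seg i a b * eV v : PathAlg k t ℓ) = if v = vtx t ℓ i b then seg i a b else 0 := by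
  rcases h.eq_or_lt with rfl | h
  · rw [seg_self, eV_mul_eV]
    by_cases h : v = vtx t ℓ i a
    · rw [if_pos h, if_pos h.symm]
    · rw [if_neg h, if_neg (Ne.symm h)]
  · rw [seg_of_lt i h, subE_mul_eV _ _ h]

lemma seg_mul_seg (i : Fin t) {a b c : ℕ} (h : a ≤ b) (h' : b ≤ c) :
    (seg i a b * seg i b c : PathAlg k t ℓ) = seg i a c := by
  rw [seg.eq_1 i b c, ← mul_assoc, seg_mul_eV _ _ h, if_pos rfl, seg, mul_assoc,
    subE_mul_subE i h h', ← seg]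

lemma seg_mul_eq_zero {i i' : Fin t} {a b c d : ℕ} (h : a ≤ b)
    (h' : vtx t ℓ i b ≠ vtx t ℓ i' c) : (seg i a b * seg i' c d : PathAlg k t ℓ) = 0 := by
  rw [seg.eq_1 i' c d, ← mul_assoc, seg_mul_eV _ _ h, if_neg h'.symm, zero_mul]

lemma mul_mul_eq_sum (x y z : PathAlg k t ℓ) :
    x * y * z = ∑ p, coef p y • (x * pathE k p * z) := by
  conv_lhs => rw [← sum_coef_smul_pathE y, Finset.mul_sum, Finset.sum_mul]
  refine Finset.sum_congr rfl fun p _ => ?_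
  rw [mul_smul_comm, smul_mul_assoc]

/-- Completing a path to a full branch on both sides kills every other path, provided the path is
not itself a full branch. -/
lemma seg_mul_mul_seg (i : Fin t) {a b : ℕ} (hab : a < b) (hb : b ≤ ℓ i) (h : a ≠ 0 ∨ b < ℓ i)
    (x : PathAlg k t ℓ) :
    seg i 0 a * x * seg i b (ℓ i) = coef (.sub i a b hab hb) x • wE i := by
  rw [mul_mul_eq_sum, Finset.sum_eq_single (PIdx.sub i a b hab hb)]
  · simp only [pathE]
    rw [← seg_of_lt i hab, seg_mul_seg i (by omega) hab.le, seg_mul_seg i (by omega) hb,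
      seg_of_lt i (by omega), wE]
  · rintro (w | ⟨i', a', b', hab', hb'⟩) - hp
    · simp only [pathE]
      by_cases h1 : w = vtx t ℓ i a
      · rw [seg_mul_eV _ _ (by omega), if_pos h1, seg_mul_eq_zero (by omega), smul_zero]
        intro h2
        obtain ⟨-, rfl⟩ := vtx_inj (by omega) (by omega) h2
        omega
      · rw [seg_mul_eV _ _ (by omega), if_neg h1, zero_mul, smul_zero]
    · simp only [pathE]
      rw [← seg_of_lt i' hab']
      by_cases h1 : vtx t ℓ i a = vtx t ℓ i' a'
      · by_cases h2 : vtx t ℓ i' b' = vtx t ℓ i b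
        · refine absurd ?_ hp
          have h3 : i' = i ∧ a' = a ∧ b' = b := by
            by_cases ha : a = 0
            · subst ha
              obtain ⟨rfl, rfl⟩ := vtx_inj (by omega) (by omega) h2.symm
              exact ⟨rfl, vtx_eq_src h1.symm, rfl⟩
            · obtain ⟨rfl, rfl⟩ := vtx_inj (by omega) ha h1.symm
              refine ⟨rfl, rfl, ?_⟩
              rcases hb.eq_or_lt with rfl | hb2
              · rcases hb'.eq_or_lt with rfl | hb3
                · rfl
                · exact (vtx_inj hb3 (by omega) h2).2
              · exact (vtx_inj hb2 (by omega) h2.symm).2.symm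
          obtain ⟨rfl, rfl, rfl⟩ := h3
          rfl
        · rw [mul_assoc, seg_mul_eq_zero hab'.le h2, mul_zero, smul_zero]
      · rw [seg_mul_eq_zero (by omega) h1, zero_mul, smul_zero]
  · simp

lemma eV_src_mul_mul_eV_snk (hℓ : ∀ i, 1 ≤ ℓ i) (x : PathAlg k t ℓ) :
    eV .src * x * eV .snk = ∑ i, coef (.sub i 0 (ℓ i) (hℓ i) le_rfl) x • wE i := by
  have key : ∀ p, (eV .src * pathE k p * eV .snk : PathAlg k t ℓ) =
      ∑ i, coef (.sub i 0 (ℓ i) (hℓ i) le_rfl) (pathE k p) • wE i := by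
    rintro (w | ⟨i, a, b, hab, hb⟩)
    · rw [Finset.sum_eq_zero fun i _ => by rw [coef_pathE, if_neg (by simp), zero_smul]]
      simp only [pathE]
      rw [eV_mul_eV]
      split_ifs
      · rw [eV_mul_eV, if_neg (by simp)]
      · rw [zero_mul]
    · simp only [coef_pathE]
      simp only [pathE]
      by_cases h : a = 0 ∧ b = ℓ i
      · obtain ⟨rfl, rfl⟩ := h
        rw [eV_mul_subE _ _ hab, if_pos (vtx_zero i).symm, subE_mul_eV _ _ hab,
          if_pos (vtx_top i hab.ne' le_rfl).symm, Finset.sum_eq_single i, if_pos rfl, one_smul, wE]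
        · intro j _ hj
          rw [if_neg, zero_smul]
          intro h
          exact hj (PIdx.sub.inj h).1
        · simp
      · rw [Finset.sum_eq_zero]
        · rw [eV_mul_subE _ _ hab]
          by_cases ha : Vtx.src = vtx t ℓ i a
          · have ha' := vtx_eq_src ha.symm
            rw [if_pos ha, subE_mul_eV _ _ hab, if_neg]
            intro h2
            have := vtx_eq_snk h2.symm
            omega
          · rw [if_neg ha, zero_mul]
        · intro j _
          rw [if_neg, zero_smul]
          intro h2
          obtain ⟨rfl, h3, h4⟩ := PIdx.sub.inj h2
          exact h ⟨h3.symm, h4.symm⟩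
  rw [mul_mul_eq_sum]
  simp only [key, Finset.smul_sum]
  rw [Finset.sum_comm]
  refine Finset.sum_congr rfl fun i _ => ?_
  simp only [smul_smul, ← Finset.sum_smul, coef_pathE]
  simp

lemma eV_mul_mul_eV_eq_zero {i i' : Fin t} {c : ℕ} (h0 : c ≠ 0) (hi' : c < ℓ i')
    {x : PathAlg k t ℓ} (hx : coef (.vert (vtx t ℓ i c)) x = 0) :
    eV (vtx t ℓ i c) * x * eV (vtx t ℓ i' c) = 0 := by
  rw [mul_mul_eq_sum]
  refine Finset.sum_eq_zero ?_
  rintro (w | ⟨j, a, b, hab, hb⟩) -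
  · by_cases h : vtx t ℓ i c = w
    · rw [← h, hx, zero_smul]
    · simp only [pathE]
      rw [eV_mul_eV, if_neg h, zero_mul, smul_zero]
  · simp only [pathE]
    rw [eV_mul_subE _ _ hab]
    by_cases h : vtx t ℓ i c = vtx t ℓ j a
    · rw [if_pos h, subE_mul_eV _ _ hab, if_neg, smul_zero]
      intro h'
      have h1 := (vtx_inj hi' (by omega) h').2
      have h2 := (vtx_inj (by omega) h0 h.symm).2
      omega
    · rw [if_neg h, zero_mul, smul_zero]

variable (k t ℓ) in
/-- The sum of all arrows which do not end at the sink. -/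
def arrowSum : PathAlg k t ℓ := ∑ i, ∑ j ∈ Finset.range (ℓ i - 1), arE i j

lemma arrowSum_mul_subE (i : Fin t) {j : ℕ} (h : j + 1 < ℓ i) :
    arrowSum k t ℓ * subE i (j + 1) (ℓ i) = subE i j (ℓ i) := by
  simp only [arrowSum, Finset.sum_mul, arE_mul_subE _ i _ h le_rfl]
  rw [Finset.sum_eq_single i, Finset.sum_eq_single j]
  · simp
  · intro j' _ hj'
    rw [if_neg (by omega)]
  · intro h'
    simp at h'
    omega
  · intro i' _ hi'
    refine Finset.sum_eq_zero fun j' _ => ?_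
    rw [if_neg (fun h => hi' h.1.symm)]
  · simp

lemma coef_arrowSum_mul (i : Fin t) {j : ℕ} (h : j + 1 < ℓ i) (x : PathAlg k t ℓ) :
    coef (.sub i j (j + 1) (Nat.lt_succ_self j) h.le) (arrowSum k t ℓ * x) =
      coef (.vert (vtx t ℓ i (j + 1))) x := by
  simp only [arrowSum, Finset.sum_mul, map_sum, coef_arE_mul, strip]
  rw [Finset.sum_eq_single i, Finset.sum_eq_single j]
  · simp
  · intro j' _ hj'
    rw [dif_neg (by omega)]
    rfl
  · intro h'
    simp at h'
    omega
  · intro i' _ hi'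
    refine Finset.sum_eq_zero fun j' _ => ?_
    rw [dif_neg (fun h => hi' h.1.symm)]
    rfl
  · simp

end Paths

section Quotient

variable {k : Type u} [Field k] (T : ToupieAlg k)

/-- The quotient map `kQ → A` as a homomorphism of algebras. -/
def mkAlgHom : PathAlg k T.t T.ℓ →ₐ[k] Alg T :=
  { mkA T with commutes' := fun _ => rfl }

lemma mkAlgHom_surjective : Function.Surjective (mkAlgHom T) := mkA_surjective T

variable {T}

lemma mkAlgHom_eq_zero {x : PathAlg k T.t T.ℓ} : mkAlgHom T x = 0 ↔ x ∈ T.I := by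
  rw [TwoSidedIdeal.mem_iff]
  exact T.I.ringCon.eq

lemma smul_mem_I (c : k) {x : PathAlg k T.t T.ℓ} (hx : x ∈ T.I) : c • x ∈ T.I := by
  rw [← mkAlgHom_eq_zero] at hx ⊢
  rw [map_smul, hx, smul_zero]

/-- The elements of an admissible ideal have no coefficients at paths of length at most one. -/
lemma coef_eq_zero_of_mem {x : PathAlg k T.t T.ℓ} (hx : x ∈ T.I) (p : PIdx T.t T.ℓ)
    (hp : ∀ i a b hab hb, p = .sub i a b hab hb → b ≤ a + 1) : coef p x = 0 := by
  have h := T.adm x hx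
  have hle : Submodule.span k
      {y : PathAlg k T.t T.ℓ | ∃ i a b, a + 2 ≤ b ∧ b ≤ T.ℓ i ∧ y = subE i a b} ≤
      LinearMap.ker (coef p : PathAlg k T.t T.ℓ →ₗ[k] k) := by
    rw [Submodule.span_le]
    rintro _ ⟨i, a, b, hab, hb, rfl⟩
    change coef p (subE i a b) = 0
    rw [coef_subE i (by omega) hb, if_neg]
    intro h
    have := hp _ _ _ _ _ h
    omega
  exact hle h

lemma mDim_eq_iff_linearIndependent :
    mDim T = T.t ↔ LinearIndependent k fun i => mkAlgHom T (wE i) := by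
  have hr : LinearMap.range (lrMap T) =
      Submodule.span k (Set.range fun i => mkAlgHom T (wE i)) := by
    apply le_antisymm
    · rintro _ ⟨x, rfl⟩
      obtain ⟨x, rfl⟩ := mkAlgHom_surjective T x
      have h1 : lrMap T (mkAlgHom T x) = mkAlgHom T (eV .src * x * eV .snk) := by
        rw [map_mul, map_mul]
        rfl
      rw [h1, eV_src_mul_mul_eV_snk T.hℓ, map_sum]
      refine Submodule.sum_mem _ fun i _ => ?_
      rw [map_smul]
      exact Submodule.smul_mem _ _ (Submodule.subset_span ⟨i, rfl⟩)
    · rw [Submodule.span_le]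
      rintro _ ⟨i, rfl⟩
      refine ⟨mkAlgHom T (wE i), ?_⟩
      have h1 : lrMap T (mkAlgHom T (wE i)) = mkAlgHom T (eV .src * wE i * eV .snk) := by
        rw [map_mul, map_mul]
        rfl
      have h0 : 0 < T.ℓ i := T.hℓ i
      rw [h1, wE, eV_mul_subE _ _ h0, if_pos (vtx_zero i).symm, subE_mul_eV _ _ h0,
        if_pos (vtx_top i h0.ne' le_rfl).symm]
      rfl
  rw [linearIndependent_iff_card_eq_finrank_span, Fintype.card_fin, mDim, hr, Set.finrank, eq_comm]

lemma eq_zero_of_mem (h : LinearIndependent k fun i => mkAlgHom T (wE i))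
    {x : PathAlg k T.t T.ℓ} (hx : x ∈ T.I) : x = 0 := by
  have hc : ∀ p, coef p x = 0 := by
    rintro (w | ⟨i, a, b, hab, hb⟩)
    · exact coef_eq_zero_of_mem hx _ (by simp)
    · by_cases h0 : a ≠ 0 ∨ b < T.ℓ i
      · have h1 := T.I.mul_mem_right _ (seg i b (T.ℓ i)) (T.I.mul_mem_left (seg i 0 a) _ hx)
        rw [seg_mul_mul_seg i hab hb h0, ← mkAlgHom_eq_zero, map_smul] at h1
        exact (smul_eq_zero.1 h1).resolve_right (h.ne_zero i)
      · obtain ⟨rfl, rfl⟩ : a = 0 ∧ b = T.ℓ i := by omega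
        have h1 := T.I.mul_mem_right _ (eV .snk) (T.I.mul_mem_left (eV .src) _ hx)
        rw [eV_src_mul_mul_eV_snk T.hℓ, ← mkAlgHom_eq_zero, map_sum] at h1
        simp only [map_smul] at h1
        exact Fintype.linearIndependent_iff.1 h _ h1 i
  rw [← sum_coef_smul_pathE x]
  exact Finset.sum_eq_zero fun p _ => by rw [hc, zero_smul]

lemma hereditary_of_linearIndependent (h : LinearIndependent k fun i => mkAlgHom T (wE i)) :
    Hereditary (Alg T)ᵐᵒᵖ := by
  have hinj : Function.Injective (mkAlgHom T) :=
    (injective_iff_map_eq_zero _).2 fun x hx => eq_zero_of_mem h (mkAlgHom_eq_zero.1 hx)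
  obtain ⟨d, hd⟩ := exists_isBarSplitting_of_algEquiv
    (AlgEquiv.ofBijective (mkAlgHom T) ⟨hinj, mkAlgHom_surjective T⟩)
  obtain ⟨d', hd'⟩ := hd.of_antiEquiv (opLinearEquiv k : Alg T ≃ₗ[k] (Alg T)ᵐᵒᵖ) rfl
    fun _ _ => rfl
  exact hd'.hereditary

/-- If `A` is hereditary, the right annihilator of the sum of the arrows not ending at the sink is
fixed by an element without coefficients at the inner vertices. -/
lemma exists_mkAlgHom_mul_eq (h : Hereditary (Alg T)ᵐᵒᵖ) :
    ∃ g : PathAlg k T.t T.ℓ,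
      (∀ i j, j + 1 < T.ℓ i → coef (.vert (vtx T.t T.ℓ i (j + 1))) g = 0) ∧
        ∀ y, arrowSum k T.t T.ℓ * y ∈ T.I → mkAlgHom T (g * y) = mkAlgHom T y := by
  obtain ⟨g, hg, hgy⟩ := h.exists_annihilator_generator (mkAlgHom T (arrowSum k T.t T.ℓ))
  obtain ⟨g, rfl⟩ := mkAlgHom_surjective T g
  refine ⟨g, fun i j hj => ?_, fun y hy => ?_⟩
  · rw [← map_mul, mkAlgHom_eq_zero] at hg
    rw [← coef_arrowSum_mul i hj]
    refine coef_eq_zero_of_mem hg _ ?_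
    rintro _ _ _ _ _ ⟨⟩
    exact le_rfl
  · rw [map_mul]
    apply hgy
    rwa [← map_mul, mkAlgHom_eq_zero]

lemma smul_subE_mem (h : Hereditary (Alg T)ᵐᵒᵖ) (S : Finset (Fin T.t)) (lam : Fin T.t → k) (j : ℕ)
    (hS : ∀ i ∈ S, j + 1 < T.ℓ i) (hmem : ∑ i ∈ S, lam i • subE i j (T.ℓ i) ∈ T.I) :
    ∀ i ∈ S, lam i • subE i (j + 1) (T.ℓ i) ∈ T.I := by
  intro i hi
  obtain ⟨g, hg, hgy⟩ := exists_mkAlgHom_mul_eq h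
  let y : PathAlg k T.t T.ℓ := ∑ i ∈ S, lam i • subE i (j + 1) (T.ℓ i)
  let e : PathAlg k T.t T.ℓ := eV (vtx T.t T.ℓ i (j + 1))
  have h1 : arrowSum k T.t T.ℓ * y = ∑ i ∈ S, lam i • subE i j (T.ℓ i) := by
    simp only [y, Finset.mul_sum]
    refine Finset.sum_congr rfl fun i hi => ?_
    rw [mul_smul_comm, arrowSum_mul_subE i (hS i hi)]
  have h2 : e * (g * y) = 0 := by
    simp only [y, Finset.mul_sum]
    refine Finset.sum_eq_zero fun i' hi' => ?_
    rw [← seg_of_lt i' (hS i' hi'), seg, mul_smul_comm, mul_smul_comm, ← mul_assoc, ← mul_assoc,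
      eV_mul_mul_eV_eq_zero (Nat.succ_ne_zero j) (hS i' hi') (hg i j (hS i hi)),
      zero_mul, smul_zero]
  have h3 : e * y = lam i • subE i (j + 1) (T.ℓ i) := by
    simp only [y, Finset.mul_sum]
    rw [Finset.sum_eq_single i]
    · rw [mul_smul_comm, eV_mul_subE _ _ (hS i hi), if_pos rfl]
    · intro i' hi' hne
      rw [mul_smul_comm, eV_mul_subE _ _ (hS i' hi'), if_neg, smul_zero]
      intro h
      exact hne (vtx_inj (hS i hi) (Nat.succ_ne_zero j) h).1.symm
    · exact fun h => absurd hi h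
  rw [← mkAlgHom_eq_zero, ← h3, map_mul, ← hgy y (h1 ▸ hmem), ← map_mul, h2, map_zero]

lemma subE_notMem (h : Hereditary (Alg T)ᵐᵒᵖ) (i : Fin T.t) {j : ℕ} (hj : j < T.ℓ i) :
    subE i j (T.ℓ i) ∉ T.I := by
  obtain ⟨n, hn⟩ : ∃ n, T.ℓ i = j + 1 + n := ⟨T.ℓ i - (j + 1), by omega⟩
  induction n generalizing j with
  | zero =>
    intro hmem
    have := coef_eq_zero_of_mem hmem (.sub i j (T.ℓ i) hj le_rfl)
      (by rintro _ _ _ _ _ ⟨⟩; omega)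
    rw [coef_subE i hj le_rfl, if_pos rfl] at this
    exact one_ne_zero this
  | succ n ih =>
    intro hmem
    refine ih (j := j + 1) (by omega) (by omega) ?_
    simpa using smul_subE_mem h {i} (fun _ => 1) j (by simp; omega) (by simpa using hmem) i
      (Finset.mem_singleton_self i)

lemma linearIndependent_of_hereditary (h : Hereditary (Alg T)ᵐᵒᵖ) :
    LinearIndependent k fun i => mkAlgHom T (wE i) := by
  rw [Fintype.linearIndependent_iff]
  intro lam hlam
  have hmem : ∑ i, lam i • wE i ∈ T.I := by
    rw [← mkAlgHom_eq_zero, map_sum]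
    simpa only [map_smul] using hlam
  have h1 : ∀ i, ¬ 1 < T.ℓ i → lam i = 0 := by
    intro i hi
    have hc := coef_eq_zero_of_mem hmem (.sub i 0 (T.ℓ i) (T.hℓ i) le_rfl)
      (by rintro _ _ _ _ _ ⟨⟩; omega)
    rw [map_sum, Finset.sum_eq_single i] at hc
    · rwa [map_smul, wE, coef_subE i (T.hℓ i) le_rfl, if_pos rfl, smul_eq_mul, mul_one] at hc
    · intro i' _ hne
      rw [map_smul, wE, coef_subE i' (T.hℓ i') le_rfl, if_neg, smul_zero]
      intro h
      exact hne (PIdx.sub.inj h).1.symm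
    · simp
  intro i
  by_cases hi : 1 < T.ℓ i
  swap
  · exact h1 i hi
  have h2 : ∑ i ∈ Finset.univ.filter (fun i => 1 < T.ℓ i), lam i • subE i 0 (T.ℓ i) ∈ T.I := by
    rw [Finset.sum_filter_of_ne]
    · exact hmem
    · intro i _ hne
      by_contra hi
      exact hne (by rw [h1 i hi, zero_smul])
  have h3 := smul_subE_mem h _ lam 0 (fun i hi => (Finset.mem_filter.1 hi).2) h2 i
    (Finset.mem_filter.2 ⟨Finset.mem_univ i, hi⟩)
  by_contra hne
  apply subE_notMem h i hi
  simpa [smul_smul, inv_mul_cancel₀ hne] using smul_mem_I (lam i)⁻¹ h3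

end Quotient

end Toupie

namespace Toupie

/-- Let `A = kQ/I` be a toupie algebra over a field `k` with `t ≥ 2`
branches and `m = dim_k e₀ A e∞`.  Then `A` is hereditary (gl.dim `A ≤ 1`) if and only
if `m = t`. -/
theorem hereditary_iff_mDim_eq_t {k : Type u} [Field k] (T : ToupieAlg k) :
    Hereditary (Alg T)ᵐᵒᵖ ↔ mDim T = T.t := by
  rw [mDim_eq_iff_linearIndependent]
  exact ⟨linearIndependent_of_hereditary, hereditary_of_linearIndependent⟩

end Toupie
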